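/- arXiv:1904.13109 — 2 statements merged into one kernel-verified Lean document; each statement's English description precedes it below -/
import Mathlib

section
/- For every integer d > 2 there exists a constant C = C(d) > 0 such that for every number field K of degree d over ℚ, the number h_2(K) of elements of order dividing 2 in the ideal class group of K satisfies: h_2(K) ≤ C·|Δ_K|^{1/2 − 1/(2d)} if d is odd, and h_2(K) ≤ C·|Δ_K|^{1/2 − 1/(2d)}·log|Δ_K| if d is even; here Δ_K denotes the discriminant of K. -/
section

open Polynomial

/-- one step of the Stepanov derivative -/
noncomputable def stepOp {F : Type*} [Field F] (f : F[X]) (N : ℕ) : F[X] →ₗ[F] F[X] where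
  toFun u := (N : F[X]) * derivative f * u + f * derivative u
  map_add' u v := by simp; ring
  map_smul' a u := by simp [smul_eq_C_mul]; ring

noncomputable def iterOp {F : Type*} [Field F] (f : F[X]) (N : ℕ) : ℕ → F[X] →ₗ[F] F[X]
  | 0 => LinearMap.id
  | k + 1 => (stepOp f (N - k)).comp (iterOp f N k)

lemma iterate_derivative_iterOp {F : Type*} [Field F] (f u : F[X]) (N k : ℕ) (hk : k ≤ N) :
    derivative^[k] (f ^ N * u) = f ^ (N - k) * iterOp f N k u := by
  induction k with
  | zero => simp [iterOp]
  | succ k ih =>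
    rw [Function.iterate_succ_apply', ih (by omega)]
    have h : N - k = (N - (k+1)) + 1 := by omega
    simp only [iterOp, LinearMap.comp_apply, stepOp, LinearMap.coe_mk, AddHom.coe_mk]
    rw [h]
    simp only [derivative_mul, derivative_pow]
    simp
    ring

lemma iterOp_mem {F : Type*} [Field F] {f : F[X]} {m : ℕ} (hf : f.natDegree ≤ m) (N R : ℕ)
    {u : F[X]} (hu : u ∈ degreeLT F R) (k : ℕ) : iterOp f N k u ∈ degreeLT F (R + k * m) := by
  induction k with
  | zero => simpa [iterOp] using hu
  | succ k ih =>
    simp only [iterOp, LinearMap.comp_apply, stepOp, LinearMap.coe_mk, AddHom.coe_mk]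
    set v := iterOp f N k u with hv
    have hf' : f.degree ≤ m := natDegree_le_iff_degree_le.mp hf
    rw [mem_degreeLT] at ih
    have key : ∀ a b : F[X], a.degree ≤ m → b.degree < (R + k * m : ℕ) →
        a * b ∈ degreeLT F (R + (k + 1) * m) := by
      intro a b ha hb
      rw [mem_degreeLT]
      rcases eq_or_ne b 0 with rfl | hb0
      · simp only [mul_zero, degree_zero]; exact WithBot.bot_lt_coe _
      rcases eq_or_ne a 0 with rfl | ha0
      · simp only [zero_mul, degree_zero]; exact WithBot.bot_lt_coe _
      rw [degree_mul, degree_eq_natDegree ha0, degree_eq_natDegree hb0]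
      rw [degree_eq_natDegree ha0] at ha
      rw [degree_eq_natDegree hb0] at hb
      norm_cast at ha hb ⊢
      nlinarith
    refine Submodule.add_mem _ ?_ ?_
    · refine key _ _ ?_ ih
      have : ((N - k : ℕ) : F[X]) * derivative f = ((N - k : ℕ) : F) • derivative f := by
        rw [smul_eq_C_mul]; simp
      rw [this]
      exact (degree_smul_le _ _).trans ((degree_derivative_le).trans hf')
    · refine key _ _ hf' (lt_of_le_of_lt degree_derivative_le ih)

lemma iterate_derivative_mul_X_pow_char {p : ℕ} [Fact p.Prime] (u : (ZMod p)[X]) (j k : ℕ) :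
    derivative^[k] (u * X ^ (j * p)) = derivative^[k] u * X ^ (j * p) := by
  induction k with
  | zero => simp
  | succ k ih =>
    rw [Function.iterate_succ_apply', ih, Function.iterate_succ_apply']
    simp [derivative_mul, derivative_X_pow]

lemma stepanov_nonvanish {p : ℕ} [Fact p.Prime] (hp2 : p ≠ 2) {f : (ZMod p)[X]} {m R J : ℕ}
    (hf : f.natDegree ≤ m) (hf0 : f.coeff 0 ≠ 0)
    (hns : ¬ ∃ (a : ZMod p) (h : (ZMod p)[X]), f = C a * h ^ 2)
    (hR : 2 * R + m ≤ p + 1) (r s : Fin J → (ZMod p)[X])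
    (hr : ∀ j, r j ∈ degreeLT (ZMod p) R) (hs : ∀ j, s j ∈ degreeLT (ZMod p) R)
    (H : ∑ j, (r j + s j * f ^ ((p - 1) / 2)) * X ^ ((j : ℕ) * p) = 0) :
    ∀ j, r j = 0 ∧ s j = 0 := by
  have hp := (Fact.out : p.Prime)
  by_contra hcon
  push Not at hcon
  -- minimal index
  have hex : ∃ k : ℕ, ∃ h : k < J, ¬ (r ⟨k, h⟩ = 0 ∧ s ⟨k, h⟩ = 0) := by
    obtain ⟨j, hj⟩ := hcon
    exact ⟨j, j.2, fun h => hj h.1 h.2⟩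
  classical
  obtain ⟨hkJ, hk⟩ := Nat.find_spec hex
  set k := Nat.find hex with hkdef
  have hmin : ∀ j : Fin J, (j : ℕ) < k → r j = 0 ∧ s j = 0 := by
    intro j hj
    have := Nat.find_min hex hj
    push Not at this
    exact this j.2
  set K : Fin J := ⟨k, hkJ⟩
  set g := f ^ ((p - 1) / 2) with hg
  -- X^p divides r_k + s_k g
  have hdiv : X ^ p ∣ r K + s K * g := by
    have h1 : X ^ ((k + 1) * p) ∣ (r K + s K * g) * X ^ (k * p) := by
      rw [← Finset.add_sum_erase _ _ (Finset.mem_univ K)] at H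
      rw [eq_neg_of_add_eq_zero_left H]
      rw [dvd_neg]
      refine Finset.dvd_sum fun j hj => ?_
      rcases lt_trichotomy (j : ℕ) k with h | h | h
      · obtain ⟨h1, h2⟩ := hmin j h
        simp [h1, h2]
      · exact absurd (Fin.ext h) (Finset.ne_of_mem_erase hj)
      · exact Dvd.dvd.mul_left (pow_dvd_pow _ (Nat.mul_le_mul_right _ h)) _
    rw [add_mul, one_mul, pow_add, mul_comm (X ^ (k * p)) (X ^ p)] at h1
    exact (mul_dvd_mul_iff_right (pow_ne_zero _ X_ne_zero)).mp h1
  have hfp : X ^ p ∣ f ^ p - C (f.coeff 0) := by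
    have : f ^ p = expand (ZMod p) p f := by
      rw [ZMod.expand_card]
    rw [this]
    have h2 : X ∣ f - C (f.coeff 0) := by
      rw [X_dvd_iff]; simp
    obtain ⟨q, hq⟩ := h2
    refine ⟨expand (ZMod p) p q, ?_⟩
    have := congrArg (expand (ZMod p) p) hq
    simpa using this
  have hgg : g * g * f = f ^ p := by
    rw [hg, ← pow_add, ← pow_succ]
    congr 1
    obtain ⟨t, ht⟩ := hp.odd_of_ne_two hp2
    omega
  have hdiv2 : X ^ p ∣ r K ^ 2 * f - C (f.coeff 0) * s K ^ 2 := by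
    have e : r K ^ 2 * f - C (f.coeff 0) * s K ^ 2 =
        (r K + s K * g) * ((r K - s K * g) * f) + s K ^ 2 * (f ^ p - C (f.coeff 0)) := by
      rw [← hgg]; ring
    rw [e]
    exact dvd_add (Dvd.dvd.mul_right hdiv _) (Dvd.dvd.mul_left hfp _)
  have hR0 : ∀ u : (ZMod p)[X], u ∈ degreeLT (ZMod p) R → u ≠ 0 → u.natDegree + 1 ≤ R := by
    intro u hu hu0
    rw [mem_degreeLT, degree_eq_natDegree hu0] at hu
    exact_mod_cast hu
  have hzero : r K ^ 2 * f - C (f.coeff 0) * s K ^ 2 = 0 := by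
    refine eq_zero_of_dvd_of_degree_lt hdiv2 ?_
    rw [degree_X_pow]
    refine lt_of_le_of_lt (degree_sub_le _ _) (max_lt ?_ ?_)
    · by_cases h : r K = 0
      · simp [h];
      · have := hR0 _ (hr K) h
        refine lt_of_le_of_lt degree_le_natDegree ?_
        have h3 : (r K ^ 2 * f).natDegree ≤ 2 * (r K).natDegree + f.natDegree :=
          natDegree_mul_le.trans (by gcongr; exact natDegree_pow_le)
        norm_cast
        omega
    · by_cases h : s K = 0
      · simp [h];
      · have := hR0 _ (hs K) h
        refine lt_of_le_of_lt degree_le_natDegree ?_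
        have h3 : (C (f.coeff 0) * s K ^ 2).natDegree ≤ 2 * (s K).natDegree :=
          (natDegree_C_mul_le _ _).trans natDegree_pow_le
        norm_cast
        omega
  have hrK : r K ≠ 0 := by
    intro h
    rw [h] at hzero
    apply hk
    refine ⟨h, ?_⟩
    simpa [hf0] using hzero
  apply hns
  have hd : r K ^ 2 ∣ s K ^ 2 := by
    refine ⟨f * C (f.coeff 0)⁻¹, ?_⟩
    have : C (f.coeff 0) * C (f.coeff 0)⁻¹ = (1 : (ZMod p)[X]) := by
      rw [← C_mul, mul_inv_cancel₀ hf0, C_1]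
    linear_combination (-C (f.coeff 0)⁻¹) * hzero - s K ^ 2 * this
  rw [IsIntegrallyClosed.pow_dvd_pow_iff two_ne_zero] at hd
  obtain ⟨h, hh⟩ := hd
  refine ⟨f.coeff 0, h, ?_⟩
  rw [hh] at hzero
  have : r K ^ 2 * (f - C (f.coeff 0) * h ^ 2) = 0 := by linear_combination hzero
  rcases mul_eq_zero.mp this with h1 | h1
  · exact absurd (pow_eq_zero_iff two_ne_zero |>.mp h1) hrK
  · exact sub_eq_zero.mp h1

lemma stepanov_core {p : ℕ} [Fact p.Prime] (hp2 : p ≠ 2) {f : (ZMod p)[X]} {m R J l : ℕ}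
    (hf : f.natDegree ≤ m) (hf0 : f.coeff 0 ≠ 0)
    (hns : ¬ ∃ (a : ZMod p) (h : (ZMod p)[X]), f = C a * h ^ 2)
    (hR : 2 * R + m ≤ p + 1) (hl : l ≤ p) (hdim : l * (R + l * m + J) < 2 * J * R) :
    l * (Finset.univ.filter (fun x : ZMod p => f.eval x ^ ((p - 1) / 2) = 1)).card ≤
      l * m + R + m * ((p - 1) / 2) + J * p := by
  classical
  have hp := (Fact.out : p.Prime)
  set F := ZMod p
  set h := (p - 1) / 2 with hh
  set M := R + l * m + J with hM
  let V := (Fin J → degreeLT F R) × (Fin J → degreeLT F R)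
  let P : ℕ → V →ₗ[F] F[X] := fun k =>
    ∑ j : Fin J, (LinearMap.mulRight F (X ^ (j : ℕ) : F[X])).comp
      ((iterOp f l k).comp ((degreeLT F R).subtype.comp
          ((LinearMap.proj j).comp (LinearMap.fst F _ _))) +
       (iterOp f (l + h) k).comp ((degreeLT F R).subtype.comp
          ((LinearMap.proj j).comp (LinearMap.snd F _ _))))
  have hP : ∀ k v, P k v = ∑ j : Fin J, (iterOp f l k (v.1 j) + iterOp f (l + h) k (v.2 j)) * X ^ (j : ℕ) := by
    intro k v
    simp [P, LinearMap.sum_apply]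
    rfl
  let Φ : V →ₗ[F] (Fin l → Fin M → F) :=
    LinearMap.pi fun k => LinearMap.pi fun i => (lcoeff F i).comp (P k)
  have hfin : Module.finrank F (Fin l → Fin M → F) < Module.finrank F V := by
    have e : Module.finrank F (degreeLT F R) = R := by
      rw [(degreeLTEquiv F R).finrank_eq]; simp
    simp only [V, Module.finrank_prod, Module.finrank_pi_fintype, e, Finset.sum_const,
      Finset.card_univ, Fintype.card_fin, smul_eq_mul, Module.finrank_self, mul_one]
    nlinarith
  have : Module.Finite F (degreeLT F R) := Module.Finite.equiv (degreeLTEquiv F R).symm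
  have hker := LinearMap.ker_ne_bot_of_finrank_lt (f := Φ) hfin
  obtain ⟨v, hv, hv0⟩ := (Submodule.ne_bot_iff _).mp hker
  have hPz : ∀ k < l, P k v = 0 := by
    intro k hk
    have hmem : P k v ∈ degreeLT F M := by
      rw [hP]
      refine Submodule.sum_mem _ fun j _ => ?_
      have h1 := Submodule.add_mem _ (iterOp_mem hf l R (v.1 j).2 k)
        (iterOp_mem hf (l + h) R (v.2 j).2 k)
      rw [mem_degreeLT] at h1 ⊢
      set w := iterOp f l k (v.1 j) + iterOp f (l + h) k (v.2 j)
      rcases eq_or_ne w 0 with h0 | h0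
      · rw [h0]; simp only [zero_mul, degree_zero]; exact WithBot.bot_lt_coe _
      rw [degree_mul, degree_X_pow, degree_eq_natDegree h0]
      rw [degree_eq_natDegree h0] at h1
      norm_cast at h1 ⊢
      have := j.2
      have : k * m ≤ l * m := Nat.mul_le_mul_right _ hk.le
      omega
    ext i
    rw [coeff_zero]
    by_cases hi : i < M
    · have := congrFun (congrFun (LinearMap.mem_ker.mp hv) ⟨k, hk⟩) ⟨i, hi⟩
      simpa [Φ] using this
    · rw [mem_degreeLT] at hmem
      exact coeff_eq_zero_of_degree_lt (lt_of_lt_of_le hmem (by exact_mod_cast not_lt.mp hi))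
  let H : F[X] := f ^ l * ∑ j : Fin J, ((v.1 j : F[X]) + (v.2 j : F[X]) * f ^ h) * X ^ ((j : ℕ) * p)
  have hfne : f ≠ 0 := by rintro rfl; simp at hf0
  have hH0 : H ≠ 0 := by
    intro h0
    have h1 := (mul_eq_zero.mp h0).resolve_left (pow_ne_zero _ hfne)
    have := stepanov_nonvanish hp2 hf hf0 hns hR (fun j => (v.1 j : F[X])) (fun j => (v.2 j : F[X]))
      (fun j => (v.1 j).2) (fun j => (v.2 j).2) h1
    apply hv0
    refine Prod.ext (funext fun j => Subtype.ext (this j).1) (funext fun j => Subtype.ext (this j).2)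
  have hder : ∀ k ≤ l, derivative^[k] H = f ^ (l - k) *
      ∑ j : Fin J, (iterOp f l k (v.1 j) + iterOp f (l + h) k (v.2 j) * f ^ h) * X ^ ((j : ℕ) * p) := by
    intro k hk
    have e : H = ∑ j : Fin J, (f ^ l * (v.1 j : F[X]) + f ^ (l + h) * (v.2 j : F[X])) * X ^ ((j : ℕ) * p) := by
      simp only [H, Finset.mul_sum]
      refine Finset.sum_congr rfl fun j _ => ?_
      rw [pow_add]; ring
    rw [e, iterate_derivative_sum, Finset.mul_sum]
    refine Finset.sum_congr rfl fun j _ => ?_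
    rw [iterate_derivative_mul_X_pow_char, iterate_map_add derivative, iterate_derivative_iterOp _ _ _ _ hk,
      iterate_derivative_iterOp _ _ _ _ (by omega)]
    have : l + h - k = (l - k) + h := by omega
    rw [this, pow_add]; ring
  have hdegH : H.natDegree ≤ l * m + R + m * h + J * p := by
    have h1 : (f ^ l).natDegree ≤ l * m := natDegree_pow_le.trans (Nat.mul_le_mul_left _ hf)
    have hfh : (f ^ h).natDegree ≤ m * h := natDegree_pow_le.trans (by rw [mul_comm]; exact Nat.mul_le_mul_right _ hf)
    have hd : ∀ u ∈ degreeLT F R, u.natDegree ≤ R := by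
      intro u hu
      rw [mem_degreeLT] at hu
      exact natDegree_le_of_degree_le hu.le
    have h2 : (∑ j : Fin J, ((v.1 j : F[X]) + (v.2 j : F[X]) * f ^ h) * X ^ ((j : ℕ) * p)).natDegree ≤
        R + m * h + J * p := by
      refine natDegree_sum_le_of_forall_le _ _ fun j _ => ?_
      refine natDegree_mul_le.trans ?_
      rw [natDegree_X_pow]
      refine add_le_add ?_ (Nat.mul_le_mul_right _ j.2.le)
      refine (natDegree_add_le _ _).trans (max_le ?_ ?_)
      · exact (hd _ (v.1 j).2).trans (by omega)
      · exact natDegree_mul_le.trans (add_le_add (hd _ (v.2 j).2) hfh)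
    refine natDegree_mul_le.trans ?_
    omega
  set A := Finset.univ.filter (fun x : ZMod p => f.eval x ^ h = 1) with hA
  have hmult : ∀ x ∈ A, l ≤ H.rootMultiplicity x := by
    intro x hx
    have hx' : f.eval x ^ h = 1 := by simpa [hA] using hx
    rcases Nat.eq_zero_or_pos l with h0 | hlpos
    · omega
    have : l - 1 < H.rootMultiplicity x := by
      refine lt_rootMultiplicity_of_isRoot_iterate_derivative_of_mem_nonZeroDivisors hH0 ?_ ?_
      · intro k hk
        rw [IsRoot, hder k (by omega), eval_mul, eval_finsetSum]
        have h3 := congrArg (eval x) (hPz k (by omega))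
        rw [hP, eval_finsetSum, eval_zero] at h3
        have h4 : ∑ j : Fin J, eval x ((iterOp f l k (v.1 j) + iterOp f (l + h) k (v.2 j) * f ^ h) * X ^ ((j : ℕ) * p)) = 0 := by
          rw [← h3]
          refine Finset.sum_congr rfl fun j _ => ?_
          simp only [eval_mul, eval_add, eval_pow, eval_X, hx', mul_one]
          rw [mul_comm (j : ℕ) p, pow_mul, ZMod.pow_card]
        rw [h4, mul_zero]
      · rw [mem_nonZeroDivisors_iff_ne_zero, Ne, ZMod.natCast_eq_zero_iff, hp.dvd_factorial]
        omega
    omega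
  calc l * A.card = ∑ x ∈ A, l := by simp [mul_comm]
    _ ≤ ∑ x ∈ A, H.rootMultiplicity x := Finset.sum_le_sum hmult
    _ = ∑ x ∈ A, H.roots.count x := by simp
    _ ≤ H.roots.card := by
        calc ∑ x ∈ A, H.roots.count x ≤ ∑ x ∈ A ∪ H.roots.toFinset, H.roots.count x :=
              Finset.sum_le_sum_of_subset Finset.subset_union_left
          _ = H.roots.card := Multiset.sum_count_eq_card (fun x hx => by simp at hx ⊢; exact Or.inr hx)
    _ ≤ H.natDegree := card_roots' _
    _ ≤ _ := hdegH

lemma stepanov_large {p : ℕ} [Fact p.Prime] {f : (ZMod p)[X]} {m : ℕ}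
    (hf : f.natDegree ≤ m) (hf0 : f.coeff 0 ≠ 0)
    (hns : ¬ ∃ (a : ZMod p) (h : (ZMod p)[X]), f = C a * h ^ 2)
    (hpm : (4 * m + 6) ^ 2 ≤ p) :
    ((Finset.univ.filter (fun x : ZMod p => f.eval x ^ ((p - 1) / 2) = 1)).card : ℝ) ≤
      m + p / 2 + (5 * m + 7) * √p := by
  have hp2 : p ≠ 2 := by rintro rfl; nlinarith
  set l := Nat.sqrt p with hl
  set J := (l + (4 * m + 6)) / 2 with hJ
  set R := (p - m) / 2 with hR
  have hl1 : l * l ≤ p := Nat.sqrt_le p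
  have hl2 : 4 * m + 6 ≤ l := by rw [hl, Nat.le_sqrt']; exact hpm
  have hl3 : p < (l + 1) * (l + 1) := Nat.lt_succ_sqrt p
  have hmp : 2 * m + 2 ≤ p := by nlinarith
  have hJ2 : l + 4 * m + 5 ≤ 2 * J := by omega
  have hJ3 : 2 * J ≤ l + 4 * m + 6 := by omega
  have hR2 : p ≤ 4 * R := by omega
  have h := stepanov_core (R := R) (J := J) (l := l) hp2 hf hf0 hns (by omega) (by nlinarith)
    (by
      have h1 : l * (l * m + J) ≤ p * (m + 1) := by
        calc l * (l * m + J) ≤ l * (l * m + l) := by gcongr; omega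
          _ = (l * l) * (m + 1) := by ring
          _ ≤ _ := by gcongr
      have h2 : p * (m + 1) < (4 * m + 5) * R := by
        have : 4 * (p * (m+1)) < 4 * ((4 * m + 5) * R) := by nlinarith
        omega
      have h3 : (l + 4 * m + 5) * R ≤ 2 * J * R := by gcongr
      nlinarith)
  set A := (Finset.univ.filter (fun x : ZMod p => f.eval x ^ ((p - 1) / 2) = 1)).card
  have h' : 2 * (l * A) ≤ 2 * l * m + p + m * p + (l + 4 * m + 6) * p := by
    have h1 : 2 * (m * ((p - 1) / 2)) ≤ m * p := by
      have : 2 * ((p - 1) / 2) ≤ p := by omega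
      calc 2 * (m * ((p - 1) / 2)) = m * (2 * ((p - 1) / 2)) := by ring
        _ ≤ _ := by gcongr
    have h2 : 2 * J * p ≤ (l + 4 * m + 6) * p := by gcongr
    have h3 : 2 * R ≤ p := by omega
    nlinarith
  have h'' : (2 * (l * A) : ℝ) ≤ 2 * l * m + p + m * p + (l + 4 * m + 6) * p := by exact_mod_cast h'
  have hsq : √(p:ℝ) ≤ 2 * l := by
    rw [Real.sqrt_le_left (by positivity)]
    have : (p : ℝ) < (l + 1) * (l + 1) := by exact_mod_cast hl3
    have h6 : (6:ℝ) ≤ l := by exact_mod_cast (by omega : 6 ≤ l)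
    nlinarith
  have hlpos : (0:ℝ) < l := by exact_mod_cast (by omega : 0 < l)
  have hpp : (p:ℝ) = √p * √p := (Real.mul_self_sqrt (by positivity)).symm
  have hkey : (5 * m + 7) * (p : ℝ) ≤ (5 * m + 7) * √p * (2 * l) := by
    conv_lhs => rw [hpp]
    rw [← mul_assoc]; gcongr
  have : (2 * l) * (A : ℝ) ≤ (2 * l) * (m + p / 2 + (5 * m + 7) * √p) := by nlinarith
  exact le_of_mul_le_mul_left this (by positivity)

theorem stepanov {p : ℕ} [Fact p.Prime] {f : (ZMod p)[X]} {m : ℕ}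
    (hf : f.natDegree ≤ m)
    (hns : ¬ ∃ (a : ZMod p) (h : (ZMod p)[X]), f = C a * h ^ 2) :
    ((Finset.univ.filter (fun x : ZMod p => IsSquare (f.eval x))).card : ℝ) ≤
      p / 2 + (7 * m + 7) * √p := by
  classical
  have hp := (Fact.out : p.Prime)
  have hp1 : (1:ℝ) ≤ √p := by
    rw [Real.one_le_sqrt]; exact_mod_cast hp.one_le
  by_cases hpm : (4 * m + 6) ^ 2 ≤ p
  swap
  · have h1 : ((Finset.univ.filter (fun x : ZMod p => IsSquare (f.eval x))).card : ℝ) ≤ p := by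
      have := Finset.card_filter_le (Finset.univ) (fun x : ZMod p => IsSquare (f.eval x))
      rw [Finset.card_univ, ZMod.card] at this
      exact_mod_cast this
    have h2 : √(p:ℝ) ≤ 4 * m + 6 := by
      rw [Real.sqrt_le_left (by positivity)]
      exact_mod_cast (by omega : p ≤ (4 * m + 6) ^ 2)
    have hpp : (p:ℝ) = √p * √p := (Real.mul_self_sqrt (by positivity)).symm
    have h3 : (p:ℝ) ≤ (7 * m + 7) * √p := by
      rw [hpp]
      simp only [Real.sqrt_mul_self (by positivity : 0 ≤ √(p:ℝ))]
      gcongr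
      nlinarith [(by positivity : (0:ℝ) ≤ m)]
    have : (0:ℝ) ≤ p / 2 := by positivity
    linarith
  have hp2 : p ≠ 2 := by rintro rfl; nlinarith
  have hfne : f ≠ 0 := by
    rintro rfl; exact hns ⟨0, 0, by simp⟩
  obtain ⟨x₀, hx₀⟩ : ∃ x₀ : ZMod p, f.eval x₀ ≠ 0 := by
    by_contra hcon
    push Not at hcon
    apply hfne
    refine eq_zero_of_natDegree_lt_card_of_eval_eq_zero' f Finset.univ (fun x _ => hcon x) ?_
    rw [Finset.card_univ, ZMod.card]; nlinarith
  set f₁ := f.comp (X + C x₀) with hf₁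
  have hback : f₁.comp (X - C x₀) = f := by
    rw [hf₁, comp_assoc]; simp
  have hns₁ : ¬ ∃ (a : ZMod p) (h : (ZMod p)[X]), f₁ = C a * h ^ 2 := by
    rintro ⟨a, h, hh⟩
    refine hns ⟨a, h.comp (X - C x₀), ?_⟩
    rw [← hback, hh]; simp
  have hdeg₁ : f₁.natDegree ≤ m := by
    rw [hf₁, natDegree_comp, natDegree_X_add_C, mul_one]; exact hf
  have hf0 : f₁.coeff 0 ≠ 0 := by
    rw [coeff_zero_eq_eval_zero, hf₁]; simpa using hx₀
  have hmain := stepanov_large hdeg₁ hf0 hns₁ hpm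
  have hcard : (Finset.univ.filter (fun x : ZMod p => f₁.eval x ^ ((p - 1) / 2) = 1)).card =
      (Finset.univ.filter (fun x : ZMod p => f.eval x ^ ((p - 1) / 2) = 1)).card := by
    refine Finset.card_bij (fun x _ => x + x₀) ?_ ?_ ?_
    · intro x hx; simpa [hf₁] using hx
    · intro x _ y _ h; simpa using h
    · intro y hy; refine ⟨y - x₀, ?_, by simp⟩; simpa [hf₁] using hy
  rw [hcard] at hmain
  have hsub : Finset.univ.filter (fun x : ZMod p => IsSquare (f.eval x)) ⊆
      f.roots.toFinset ∪ (Finset.univ.filter (fun x : ZMod p => f.eval x ^ ((p - 1) / 2) = 1)) := by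
    intro x hx
    rw [Finset.mem_union]
    by_cases h0 : f.eval x = 0
    · left; simpa [hfne] using h0
    · right
      have hx' : IsSquare (f.eval x) := by simpa using hx
      have h1 := (ZMod.euler_criterion p h0).mp hx'
      have h2 : p / 2 = (p - 1) / 2 := by
        obtain ⟨t, ht⟩ := hp.odd_of_ne_two hp2; omega
      rw [h2] at h1
      simpa using h1
  have hc := (Finset.card_le_card hsub).trans (Finset.card_union_le _ _)
  have hr : f.roots.toFinset.card ≤ m := (Multiset.toFinset_card_le _).trans ((card_roots' f).trans hf)
  have hc' : ((Finset.univ.filter (fun x : ZMod p => IsSquare (f.eval x))).card : ℝ) ≤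
      m + (Finset.univ.filter (fun x : ZMod p => f.eval x ^ ((p - 1) / 2) = 1)).card := by
    exact_mod_cast hc.trans (by omega)
  have : (2 * m : ℝ) ≤ 2 * m * √p := le_mul_of_one_le_right (by positivity) hp1
  linarith

end

section

open Real

lemma sum_log_primes_dvd_le (P : Finset ℕ) (hP : ∀ p ∈ P, p.Prime) (n : ℤ) (hn : n ≠ 0) :
    ∑ p ∈ P.filter (fun p : ℕ => (p : ℤ) ∣ n), log p ≤ log |(n : ℝ)| := by
  have h1 : (∏ p ∈ P.filter (fun p : ℕ => (p : ℤ) ∣ n), p) ∣ n.natAbs := by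
    refine Finset.prod_primes_dvd _ ?_ ?_
    · intro p hp; exact (hP p (Finset.mem_filter.mp hp).1).prime
    · intro p hp; exact Int.natCast_dvd.mp (Finset.mem_filter.mp hp).2
  have h2 := Nat.le_of_dvd (Int.natAbs_pos.mpr hn) h1
  have h3 : ∀ p ∈ P.filter (fun p : ℕ => (p : ℤ) ∣ n), (p : ℝ) ≠ 0 := fun p hp => by
    exact_mod_cast (hP p (Finset.mem_filter.mp hp).1).ne_zero
  rw [← log_prod h3]
  refine log_le_log ?_ ?_
  · exact Finset.prod_pos fun p hp => lt_of_le_of_ne (by positivity) (h3 p hp).symm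
  · have h4 : ((∏ p ∈ P.filter (fun p : ℕ => (p : ℤ) ∣ n), p : ℕ) : ℝ) ≤ (n.natAbs : ℝ) :=
      Nat.cast_le.mpr h2
    rw [Nat.cast_natAbs] at h4
    push_cast at h4
    exact h4

lemma card_sq_le_pairs {α β : Type*} [DecidableEq α] [DecidableEq β] (T : Finset α) (φ : α → β) :
    (T.card : ℝ) ^ 2 ≤ (T.image φ).card *
      ((T ×ˢ T).filter (fun x => φ x.1 = φ x.2)).card := by
  have h1 : (T.card : ℝ) = ∑ b ∈ T.image φ, ((T.filter (fun t => φ t = b)).card : ℝ) := by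
    rw [Finset.card_eq_sum_card_image φ T]; push_cast; rfl
  have h2 : (((T ×ˢ T).filter (fun x => φ x.1 = φ x.2)).card : ℝ) =
      ∑ b ∈ T.image φ, ((T.filter (fun t => φ t = b)).card : ℝ) ^ 2 := by
    rw [Finset.card_eq_sum_card_fiberwise (f := fun x => φ x.1) (t := T.image φ)]
    · push_cast
      refine Finset.sum_congr rfl fun b _ => ?_
      rw [sq, ← Nat.cast_mul, ← Finset.card_product]
      congr 2
      ext ⟨x, y⟩
      simp only [Finset.mem_filter, Finset.mem_product]
      constructor
      · rintro ⟨⟨⟨a, b⟩, c⟩, d⟩; exact ⟨⟨a, d⟩, b, by rw [← c, d]⟩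
      · rintro ⟨⟨a, b⟩, c, d⟩; exact ⟨⟨⟨a, c⟩, by rw [b, d]⟩, b⟩
    · intro x hx
      simp only [Finset.coe_filter, Finset.mem_product, Set.mem_ofPred_eq] at hx
      exact Finset.mem_coe.mpr (Finset.mem_image_of_mem _ hx.1.1)
  rw [h1, h2]
  exact sq_sum_le_card_mul_sum_sq

theorem larger_sieve (T : Finset ℤ) (N : ℝ) (hN : 1 ≤ N)
    (hT : ∀ s ∈ T, ∀ t ∈ T, |(s : ℝ) - t| ≤ N) (P : Finset ℕ) (hP : ∀ p ∈ P, p.Prime)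
    (ν : ℕ → ℝ) (hν0 : ∀ p ∈ P, 0 < ν p)
    (hν : ∀ p ∈ P, ((T.image (fun t : ℤ => (t : ZMod p))).card : ℝ) ≤ ν p) :
    (T.card : ℝ) * (∑ p ∈ P, log p / ν p - log N) ≤ ∑ p ∈ P, log p := by
  classical
  rcases T.eq_empty_or_nonempty with rfl | hne
  · simp only [Finset.card_empty, Nat.cast_zero, zero_mul]
    exact Finset.sum_nonneg fun p _ => log_natCast_nonneg p
  have hlogN : 0 ≤ log N := log_nonneg hN
  have hcpos : (0:ℝ) < T.card := by exact_mod_cast hne.card_pos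
  -- pairs
  let Pr : ℕ → Finset (ℤ × ℤ) := fun p => (T ×ˢ T).filter (fun x => (x.1 : ZMod p) = (x.2 : ZMod p))
  have hlow : ∀ p ∈ P, log p * ((T.card : ℝ) ^ 2 / ν p - T.card) ≤
      ∑ x ∈ T.offDiag, if (p : ℤ) ∣ x.1 - x.2 then log p else 0 := by
    intro p hp
    have h1 := card_sq_le_pairs T (fun t : ℤ => (t : ZMod p))
    have h2 : (T.card : ℝ) ^ 2 / ν p ≤ (Pr p).card := by
      rw [div_le_iff₀ (hν0 p hp)]
      refine h1.trans ?_
      rw [mul_comm]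
      gcongr
      exact hν p hp
    have h3 : ((Pr p).card : ℝ) ≤ T.card + ((T.offDiag).filter (fun x => (p : ℤ) ∣ x.1 - x.2)).card := by
      have : Pr p ⊆ T.diag ∪ (T.offDiag).filter (fun x => (p : ℤ) ∣ x.1 - x.2) := by
        intro x hx
        simp only [Pr, Finset.mem_filter, Finset.mem_product] at hx
        rw [Finset.mem_union, Finset.mem_diag, Finset.mem_filter, Finset.mem_offDiag]
        by_cases h : x.1 = x.2
        · left; exact ⟨hx.1.1, h⟩
        · right
          refine ⟨⟨hx.1.1, hx.1.2, h⟩, ?_⟩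
          exact (ZMod.intCast_eq_intCast_iff_dvd_sub x.2 x.1 p).mp hx.2.symm
      have := (Finset.card_le_card this).trans (Finset.card_union_le _ _)
      rw [Finset.diag_card] at this
      exact_mod_cast this
    rw [← Finset.sum_filter, Finset.sum_const, nsmul_eq_mul, mul_comm]
    exact mul_le_mul_of_nonneg_right (by linarith) (log_natCast_nonneg p)
  have hsum := Finset.sum_le_sum hlow
  rw [Finset.sum_comm] at hsum
  have hup : ∑ x ∈ T.offDiag, ∑ p ∈ P, (if (p : ℤ) ∣ x.1 - x.2 then log p else 0) ≤
      ∑ x ∈ T.offDiag, log N := by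
    refine Finset.sum_le_sum fun x hx => ?_
    rw [Finset.mem_offDiag] at hx
    rw [← Finset.sum_filter]
    have hne : x.1 - x.2 ≠ 0 := sub_ne_zero.mpr hx.2.2
    refine (sum_log_primes_dvd_le P hP _ hne).trans (log_le_log ?_ ?_)
    · exact abs_pos.mpr (by exact_mod_cast hne)
    · push_cast; exact hT _ hx.1 _ hx.2.1
  have hcard : ∑ x ∈ T.offDiag, log N ≤ (T.card : ℝ) ^ 2 * log N := by
    rw [Finset.sum_const, nsmul_eq_mul]
    gcongr
    rw [Finset.offDiag_card, sq]
    exact_mod_cast Nat.sub_le _ _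
  have htot := hsum.trans (hup.trans hcard)
  have e : ∑ p ∈ P, log p * ((T.card : ℝ) ^ 2 / ν p - T.card) =
      T.card * (T.card * ∑ p ∈ P, log p / ν p - ∑ p ∈ P, log p) := by
    rw [Finset.mul_sum, ← Finset.sum_sub_distrib, Finset.mul_sum]
    refine Finset.sum_congr rfl fun p _ => ?_
    ring
  rw [e] at htot
  have : T.card * (T.card * ∑ p ∈ P, log p / ν p - ∑ p ∈ P, log p) ≤ T.card * (T.card * log N) := by
    linarith
  have := le_of_mul_le_mul_left this hcpos
  linarith

lemma log_factorial_eq (n : ℕ) :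
    log (n.factorial : ℝ) = ∑ p ∈ Nat.primesLE n, (n.factorial.factorization p : ℝ) * log p := by
  rw [log_nat_eq_sum_factorization]
  rw [Finsupp.sum]
  refine Finset.sum_subset ?_ ?_
  · intro p hp
    rw [Nat.support_factorization, Nat.mem_primeFactors] at hp
    rw [Nat.mem_primesLE]
    exact ⟨(hp.1.dvd_factorial).mp hp.2.1, hp.1⟩
  · intro p _ hp
    rw [Finsupp.notMem_support_iff.mp hp]; simp

lemma mertens_upper (n : ℕ) (hn : 1 ≤ n) : ∑ p ∈ Nat.primesLE n, log p / p ≤ log n + log 4 := by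
  have hn' : (0:ℝ) < n := by exact_mod_cast hn
  have h1 : ∑ p ∈ Nat.primesLE n, ((n:ℝ) / p - 1) * log p ≤ log (n.factorial : ℝ) := by
    rw [log_factorial_eq]
    refine Finset.sum_le_sum fun p hp => ?_
    rw [Nat.mem_primesLE] at hp
    refine mul_le_mul_of_nonneg_right ?_ (log_natCast_nonneg p)
    have h2 : n / p ≤ n.factorial.factorization p := by
      rw [← hp.2.pow_dvd_iff_le_factorization (Nat.factorial_ne_zero n)]
      have h3 : p ^ (n / p) ∣ (p * (n / p)).factorial := by
        have h4 : (n/p) ≤ ((p * (n / p)).factorial).factorization p := by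
          rw [Nat.factorization_factorial_mul hp.2]; omega
        exact (hp.2.pow_dvd_iff_le_factorization (Nat.factorial_ne_zero _)).mpr h4
      exact h3.trans (Nat.factorial_dvd_factorial (Nat.mul_div_le n p))
    have h5 : (n:ℝ) / p < (n / p : ℕ) + 1 := by
      have := Nat.lt_div_mul_add (a := n) hp.2.pos
      rw [div_lt_iff₀ (by exact_mod_cast hp.2.pos)]
      have h6 : n < (n/p + 1) * p := by rw [add_mul, one_mul]; exact this
      exact_mod_cast h6
    have h6 : ((n/p : ℕ) : ℝ) ≤ n.factorial.factorization p := by exact_mod_cast h2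
    linarith
  have h2 : log (n.factorial : ℝ) ≤ n * log n := by
    rw [← log_pow]
    refine log_le_log (by exact_mod_cast n.factorial_pos) ?_
    exact_mod_cast Nat.factorial_le_pow n
  have h3 := Chebyshev.theta_le_log4_mul_x (x := n) (by positivity)
  rw [Chebyshev.theta_eq_sum_primesLE_log] at h3
  have e : ∑ p ∈ Nat.primesLE n, ((n:ℝ) / p - 1) * log p =
      n * ∑ p ∈ Nat.primesLE n, log p / p - ∑ p ∈ Nat.primesLE n, log p := by
    rw [Finset.mul_sum, ← Finset.sum_sub_distrib]
    refine Finset.sum_congr rfl fun p _ => ?_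
    ring
  have : n * ∑ p ∈ Nat.primesLE n, log p / p ≤ n * (log n + log 4) := by
    rw [e] at h1; linarith
  exact le_of_mul_le_mul_left this hn'

lemma mertens_lower (c : ℝ) (hc : 0 ≤ c) : ∃ C : ℝ, 0 ≤ C ∧ ∀ n : ℕ, 1 ≤ n →
    2 * log n - C ≤ ∑ p ∈ Nat.primesLE n, log p / (p / 2 + c * √p) := by
  have hs : Summable (fun n : ℕ => (1:ℝ) / (n:ℝ) ^ (5/4 : ℝ)) :=
    Real.summable_one_div_nat_rpow.mpr (by norm_num)
  set S := ∑' n : ℕ, (1:ℝ) / (n:ℝ) ^ (5/4 : ℝ) with hS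
  have hS0 : 0 ≤ S := tsum_nonneg fun n => by positivity
  refine ⟨2 + (16 * c + 16) * S, by positivity, fun n hn => ?_⟩
  have hn' : (0:ℝ) < n := by exact_mod_cast hn
  have h1 : log n - 1 ≤ ∑ p ∈ Nat.primesLE n, log p / ((p:ℝ) - 1) := by
    have h2 : n * log n - n ≤ log (n.factorial : ℝ) := by
      have := Stirling.le_log_factorial_stirling (n := n) (by omega)
      have h3 : 0 ≤ log (n:ℝ) / 2 := by
        have := log_natCast_nonneg n; positivity
      have h4 : 0 ≤ log (2 * π) / 2 := by
        have : 0 ≤ log (2 * π) := log_nonneg (by linarith [pi_gt_three])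
        positivity
      linarith
    rw [log_factorial_eq] at h2
    have h3 : ∑ p ∈ Nat.primesLE n, (n.factorial.factorization p : ℝ) * log p ≤
        ∑ p ∈ Nat.primesLE n, n * (log p / ((p:ℝ) - 1)) := by
      refine Finset.sum_le_sum fun p hp => ?_
      rw [Nat.mem_primesLE] at hp
      have h4 := Nat.factorization_factorial_le_div_pred hp.2 n
      have h5 : (n.factorial.factorization p : ℝ) ≤ n / ((p:ℝ) - 1) := by
        have h6 : ((n / (p - 1) : ℕ) : ℝ) ≤ n / ((p - 1 : ℕ) : ℝ) := Nat.cast_div_le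
        rw [Nat.cast_sub hp.2.one_le, Nat.cast_one] at h6
        have h7 : (n.factorial.factorization p : ℝ) ≤ ((n / (p - 1) : ℕ) : ℝ) := by exact_mod_cast h4
        exact h7.trans h6
      calc (n.factorial.factorization p : ℝ) * log p ≤ n / ((p:ℝ) - 1) * log p :=
            mul_le_mul_of_nonneg_right h5 (log_natCast_nonneg p)
        _ = _ := by ring
    rw [← Finset.mul_sum] at h3
    have : n * (log n - 1) ≤ n * ∑ p ∈ Nat.primesLE n, log p / ((p:ℝ) - 1) := by linarith
    exact le_of_mul_le_mul_left this hn'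
  have hterm : ∀ p ∈ Nat.primesLE n, 2 * (log p / ((p:ℝ) - 1)) - (16 * c + 16) * ((1:ℝ) / (p:ℝ) ^ (5/4 : ℝ)) ≤
      log p / (p / 2 + c * √p) := by
    intro p hp
    rw [Nat.mem_primesLE] at hp
    have hp2 : (2:ℝ) ≤ p := by exact_mod_cast hp.2.two_le
    have hp0 : (0:ℝ) < p := by linarith
    set y := (p:ℝ) ^ (1/4 : ℝ) with hy
    have hy0 : 0 < y := rpow_pos_of_pos hp0 _
    have hy4 : y ^ 4 = p := by
      rw [hy, ← rpow_natCast, ← rpow_mul hp0.le]; norm_num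
    have hsq : √(p:ℝ) = y ^ 2 := by
      rw [← hy4, show y ^ 4 = (y ^ 2) ^ 2 by ring, sqrt_sq (by positivity)]
    have h54 : (p:ℝ) ^ (5/4 : ℝ) = y ^ 5 := by
      rw [hy, ← rpow_natCast, ← rpow_mul hp0.le]; norm_num
    have hlog : log p ≤ 4 * y := by
      have := log_le_rpow_div hp0.le (by norm_num : (0:ℝ) < 1/4)
      rw [← hy] at this; linarith
    have hlog0 : 0 ≤ log (p:ℝ) := log_natCast_nonneg p
    have hy1 : 1 ≤ y := one_le_rpow (by linarith) (by norm_num)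
    rw [h54, hsq]
    -- 2/(p-1) - 2/p ≤ 4/p^2, and 1/(p/2+c y^2) ≥ 2/p - 4 c y^2/p^2
    have a1 : 2 / ((p:ℝ) - 1) ≤ 2 / p + 4 / (p:ℝ) ^ 2 := by
      rw [div_add_div _ _ (by positivity) (by positivity), div_le_div_iff₀ (by linarith) (by positivity)]
      nlinarith [mul_pos hp0 hp0, mul_nonneg hp0.le (by linarith : (0:ℝ) ≤ p - 2), mul_nonneg (mul_nonneg hp0.le hp0.le) (by linarith : (0:ℝ) ≤ p - 2)]
    have a2 : 2 / (p:ℝ) - 4 * c * y ^ 2 / (p:ℝ) ^ 2 ≤ 1 / (p / 2 + c * y ^ 2) := by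
      rw [div_sub_div _ _ (by positivity) (by positivity), div_le_div_iff₀ (by positivity) (by positivity)]
      have : 0 ≤ c ^ 2 * y ^ 4 * p := by positivity
      nlinarith
    have a3 : 4 * c * y ^ 2 / (p:ℝ) ^ 2 + 4 / (p:ℝ) ^ 2 ≤ (4 * c + 4) / y ^ 6 := by
      rw [← hy4, ← add_div, div_le_div_iff₀ (by positivity) (by positivity)]
      have : 4 * c * y ^ 2 + 4 ≤ (4 * c + 4) * y ^ 2 := by nlinarith
      calc (4 * c * y ^ 2 + 4) * y ^ 6 ≤ ((4 * c + 4) * y ^ 2) * y ^ 6 := by gcongr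
        _ = _ := by ring
    have a4 : log p * ((4 * c + 4) / y ^ 6) ≤ (16 * c + 16) * (1 / y ^ 5) := by
      calc log p * ((4 * c + 4) / y ^ 6) ≤ 4 * y * ((4 * c + 4) / y ^ 6) := by gcongr
        _ = _ := by field_simp; ring
    have a5 : 2 / ((p:ℝ) - 1) - (4 * c + 4) / y ^ 6 ≤ 1 / (p / 2 + c * y ^ 2) := by linarith
    have a6 := mul_le_mul_of_nonneg_left a5 hlog0
    calc _ ≤ 2 * (log p / ((p:ℝ) - 1)) - log p * ((4 * c + 4) / y ^ 6) := by linarith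
      _ = log p * (2 / ((p:ℝ) - 1) - (4 * c + 4) / y ^ 6) := by ring
      _ ≤ _ := a6
      _ = _ := by ring
  have hsum := Finset.sum_le_sum hterm
  rw [Finset.sum_sub_distrib, ← Finset.mul_sum, ← Finset.mul_sum] at hsum
  have hle : ∑ p ∈ Nat.primesLE n, (1:ℝ) / (p:ℝ) ^ (5/4 : ℝ) ≤ S :=
    hs.sum_le_tsum _ (fun i _ => by positivity)
  have : (16 * c + 16) * ∑ p ∈ Nat.primesLE n, (1:ℝ) / (p:ℝ) ^ (5/4 : ℝ) ≤ (16 * c + 16) * S := by gcongr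
  linarith

lemma sum_bad_primes (P : Finset ℕ) (hP : ∀ p ∈ P, p.Prime) (D : ℤ) (hD : D ≠ 0)
    (hPD : ∀ p ∈ P, (p : ℤ) ∣ D) (A L : ℝ) (hL : 1 ≤ L) (hDA : log |(D:ℝ)| ≤ A * L) :
    ∑ p ∈ P, log p / p ≤ log L + log 4 + A := by
  classical
  have hL0 : 0 < L := by linarith
  have hfl : 1 ≤ ⌊L⌋₊ := Nat.le_floor (by simpa using hL)
  rw [← Finset.sum_filter_add_sum_filter_not P (fun p => p ≤ ⌊L⌋₊)]
  have h1 : ∑ p ∈ P.filter (fun p => p ≤ ⌊L⌋₊), log p / p ≤ log L + log 4 := by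
    calc _ ≤ ∑ p ∈ Nat.primesLE ⌊L⌋₊, log p / p := by
          refine Finset.sum_le_sum_of_subset_of_nonneg ?_ ?_
          · intro p hp
            rw [Finset.mem_filter] at hp
            rw [Nat.mem_primesLE]; exact ⟨hp.2, hP p hp.1⟩
          · intro p _ _
            have := log_natCast_nonneg p
            positivity
      _ ≤ log ⌊L⌋₊ + log 4 := mertens_upper _ hfl
      _ ≤ _ := by
          have : log (⌊L⌋₊ : ℝ) ≤ log L := log_le_log (by exact_mod_cast hfl) (Nat.floor_le hL0.le)
          linarith
  have h2 : ∑ p ∈ P.filter (fun p => ¬ p ≤ ⌊L⌋₊), log p / p ≤ A := by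
    have h3 : ∑ p ∈ P.filter (fun p => ¬ p ≤ ⌊L⌋₊), log p / p ≤
        ∑ p ∈ P, log p / L := by
      calc _ ≤ ∑ p ∈ P.filter (fun p => ¬ p ≤ ⌊L⌋₊), log p / L := by
            refine Finset.sum_le_sum fun p hp => ?_
            rw [Finset.mem_filter, not_le] at hp
            have := Nat.lt_of_floor_lt hp.2
            exact div_le_div_of_nonneg_left (log_natCast_nonneg p) hL0 this.le
        _ ≤ _ := by
            refine Finset.sum_le_sum_of_subset_of_nonneg (Finset.filter_subset _ _) ?_
            intro p _ _
            have := log_natCast_nonneg p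
            positivity
    refine h3.trans ?_
    rw [← Finset.sum_div, div_le_iff₀ hL0]
    refine le_trans ?_ hDA
    have h4 := sum_log_primes_dvd_le P hP D hD
    rwa [Finset.filter_true_of_mem hPD] at h4
  linarith

theorem sieve_main (c A : ℝ) (hc : 0 ≤ c) : ∃ C : ℝ, 0 < C ∧
    ∀ (T : Finset ℤ) (N : ℝ) (D : ℤ) (L : ℝ), 1 ≤ N → 1 ≤ L → D ≠ 0 → log |(D:ℝ)| ≤ A * L →
    (∀ s ∈ T, ∀ t ∈ T, |(s : ℝ) - t| ≤ N) →
    (∀ p : ℕ, p.Prime → ¬ (p : ℤ) ∣ D →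
      ((T.image (fun t : ℤ => (t : ZMod p))).card : ℝ) ≤ p / 2 + c * √p) →
    (T.card : ℝ) ≤ C * (√N * L) := by
  classical
  obtain ⟨C₁, hC₁, hm⟩ := mertens_lower c hc
  set E := (C₁ + 2 * log 4 + 2 * A + 1) / 2 with hE
  refine ⟨log 4 * (exp E + 1), by have := log_pos (by norm_num : (1:ℝ) < 4); positivity, ?_⟩
  intro T N D L hN hL hD hDA hT hν
  have hsN : 1 ≤ √N := one_le_sqrt.mpr hN
  have hL0 : 0 < L := by linarith
  have hN0 : 0 < N := by linarith
  set n := ⌈exp E * (√N * L)⌉₊ with hn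
  have hn0 : 0 < exp E * (√N * L) := by positivity
  have hn1 : 1 ≤ n := Nat.one_le_ceil_iff.mpr hn0
  have hnle : exp E * (√N * L) ≤ n := Nat.le_ceil _
  have hnlt : (n:ℝ) < exp E * (√N * L) + 1 := Nat.ceil_lt_add_one hn0.le
  have hlogn : E + log N / 2 + log L ≤ log n := by
    have := log_le_log hn0 hnle
    rw [log_mul (by positivity) (by positivity), log_mul (by positivity) (by positivity), log_exp,
      log_sqrt hN0.le] at this
    linarith
  set ν : ℕ → ℝ := fun p => p / 2 + c * √p with hνdef
  set P := (Nat.primesLE n).filter (fun p : ℕ => ¬ (p : ℤ) ∣ D) with hPdef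
  have hPp : ∀ p ∈ P, p.Prime := fun p hp => (Nat.mem_primesLE.mp (Finset.mem_filter.mp hp).1).2
  have hνpos : ∀ p : ℕ, p.Prime → 0 < ν p := fun p hp => by
    have : (0:ℝ) < p := by exact_mod_cast hp.pos
    simp only [hνdef]; positivity
  have hls := larger_sieve T N hN hT P hPp ν (fun p hp => hνpos p (hPp p hp))
    (fun p hp => hν p (hPp p hp) (Finset.mem_filter.mp hp).2)
  have hsplit := Finset.sum_filter_add_sum_filter_not (Nat.primesLE n) (fun p : ℕ => (p : ℤ) ∣ D)
    (fun p : ℕ => log p / ν p)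
  have hbad : ∑ p ∈ (Nat.primesLE n).filter (fun p : ℕ => (p : ℤ) ∣ D), log p / ν p ≤
      2 * (log L + log 4 + A) := by
    have hpr : ∀ p ∈ (Nat.primesLE n).filter (fun p : ℕ => (p : ℤ) ∣ D), p.Prime :=
      fun p hp => (Nat.mem_primesLE.mp (Finset.mem_filter.mp hp).1).2
    have := sum_bad_primes _ hpr D hD (fun p hp => (Finset.mem_filter.mp hp).2) A L hL hDA
    refine le_trans ?_ (mul_le_mul_of_nonneg_left this (by norm_num))
    rw [Finset.mul_sum]
    refine Finset.sum_le_sum fun p hp => ?_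
    have hp0 : (0:ℝ) < p := by exact_mod_cast (hpr p hp).pos
    calc log p / ν p ≤ log p / (p / 2) := by
          refine div_le_div_of_nonneg_left (log_natCast_nonneg p) (by positivity) ?_
          simp only [hνdef]
          have : 0 ≤ c * √p := by positivity
          linarith
      _ = _ := by field_simp
  have hmn := hm n hn1
  have hge : 1 ≤ ∑ p ∈ P, log p / ν p - log N := by
    have e1 : ∑ p ∈ P, log p / ν p = ∑ p ∈ (Nat.primesLE n).filter (fun p : ℕ => ¬ (p : ℤ) ∣ D), log p / ν p := rfl
    have e2 : ∑ p ∈ Nat.primesLE n, log p / (p / 2 + c * √p) = ∑ p ∈ Nat.primesLE n, log p / ν p := rfl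
    rw [e2] at hmn
    rw [e1]
    linarith
  have hθ : ∑ p ∈ P, log p ≤ log 4 * n := by
    have h3 := Chebyshev.theta_le_log4_mul_x (x := n) (by positivity)
    rw [Chebyshev.theta_eq_sum_primesLE_log] at h3
    refine le_trans (Finset.sum_le_sum_of_subset_of_nonneg (Finset.filter_subset _ _) ?_) h3
    intro p _ _; exact log_natCast_nonneg p
  have hcard : (T.card : ℝ) ≤ log 4 * n := by
    have : (T.card : ℝ) * 1 ≤ (T.card : ℝ) * (∑ p ∈ P, log p / ν p - log N) :=
      mul_le_mul_of_nonneg_left hge (by positivity)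
    linarith
  refine hcard.trans ?_
  have h4 : 0 < log (4:ℝ) := log_pos (by norm_num)
  rw [mul_assoc]
  refine mul_le_mul_of_nonneg_left ?_ h4.le
  have : 1 ≤ √N * L := one_le_mul_of_one_le_of_one_le hsN hL
  nlinarith

end

section

open MeasureTheory Pointwise

theorem setIntegral_le_fundDom {E : Type*} [NormedAddCommGroup E]
    [MeasurableSpace E] [BorelSpace E] (μ : Measure E) [μ.IsAddLeftInvariant]
    (L : AddSubgroup E) [Countable L] (F B : Set E) (hF : IsAddFundamentalDomain L F μ)
    (hFm : MeasurableSet F) (hBm : MeasurableSet B)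
    (hB : ∀ x ∈ B, ∀ y ∈ B, x - y ∈ L → x = y) (G : E → ENNReal)
    (hG : ∀ (l : L) x, G (l +ᵥ x) = G x) :
    ∫⁻ x in B, G x ∂μ ≤ ∫⁻ x in F, G x ∂μ := by
  rw [hF.setLIntegral_eq_tsum' G B]
  simp_rw [hG]
  rw [← lintegral_iUnion]
  · exact lintegral_mono_set (by intro x hx; simp only [Set.mem_iUnion] at hx; obtain ⟨i, hi⟩ := hx; exact hi.2)
  · intro l
    exact (hBm.const_vadd l).inter hFm
  · intro a b hab
    rw [Function.onFun, Set.disjoint_left]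
    rintro x ⟨⟨u, hu, rfl⟩, -⟩ ⟨⟨v, hv, h⟩, -⟩
    apply hab
    have h2 : (b : E) + v = a + u := h
    have := hB u hu v hv (by
      have : u - v = ((b - a : L) : E) := by
        push_cast; rw [sub_eq_sub_iff_add_eq_add, add_comm u, add_comm (b:E)] ;
        rw [add_comm v, h2]
      rw [this]; exact (b - a).2)
    subst this
    exact Subtype.ext (add_right_cancel h2).symm

theorem integral_cos_fundDom {E : Type*} [NormedAddCommGroup E] [NormedSpace ℝ E]
    [MeasurableSpace E] [BorelSpace E] (μ : Measure E) [μ.IsAddLeftInvariant]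
    (L : AddSubgroup E) [Countable L] (F : Set E) (hF : IsAddFundamentalDomain L F μ)
    (χ : E →ₗ[ℝ] ℝ) (hχ : χ ≠ 0) (hisInt : ∀ l ∈ L, ∃ n : ℤ, χ l = n) :
    ∫ x in F, Real.cos (2 * Real.pi * χ x) ∂μ = 0 := by
  obtain ⟨w, hw⟩ : ∃ w, χ w ≠ 0 := by
    by_contra! h; exact hχ (LinearMap.ext h)
  set v : E := (2 * χ w)⁻¹ • w with hv
  have hvv : χ v = 1 / 2 := by rw [hv, map_smul, smul_eq_mul]; field_simp
  have hF2 : IsAddFundamentalDomain L (v +ᵥ F) μ := hF.vadd_of_comm v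
  have h1 := hF.setIntegral_eq hF2 (f := fun x => Real.cos (2 * Real.pi * χ x)) (by
    intro g x
    obtain ⟨n, hn⟩ := hisInt g g.2
    have : χ (g +ᵥ x) = χ x + n := by
      change χ ((g : E) + x) = _
      rw [map_add, hn, add_comm]
    beta_reduce
    rw [this, mul_add, mul_comm (2 * Real.pi) (n : ℝ), Real.cos_add_int_mul_two_pi])
  have h2 : ∫ x in v +ᵥ F, Real.cos (2 * Real.pi * χ x) ∂μ
      = ∫ x in F, Real.cos (2 * Real.pi * χ (v + x)) ∂μ := by
    have := (measurePreserving_add_left μ v).setIntegral_image_emb (MeasurableEquiv.addLeft v).measurableEmbedding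
      (fun x => Real.cos (2 * Real.pi * χ x)) F
    exact this
  have h3 : ∀ x, Real.cos (2 * Real.pi * χ (v + x)) = - Real.cos (2 * Real.pi * χ x) := by
    intro x
    rw [map_add, hvv, show 2 * Real.pi * (1/2 + χ x) = 2 * Real.pi * χ x + Real.pi by ring, Real.cos_add_pi]
  rw [h2] at h1
  simp_rw [h3] at h1
  rw [integral_neg] at h1
  linarith

theorem bessel_count {E ι : Type*} [NormedAddCommGroup E] [NormedSpace ℝ E] [FiniteDimensional ℝ E]
    [MeasurableSpace E] [BorelSpace E] (μ : Measure E) [μ.IsAddLeftInvariant]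
    (L : AddSubgroup E) [Countable L] (F B : Set E) (hF : IsAddFundamentalDomain L F μ)
    (hFm : MeasurableSet F) (hBm : MeasurableSet B) (hFf : μ F ≠ ⊤)
    (hB : ∀ x ∈ B, ∀ y ∈ B, x - y ∈ L → x = y) (S : Finset ι) (φ : ι → E →ₗ[ℝ] ℝ)
    (hφ : ∀ i ∈ S, ∀ j ∈ S, i ≠ j → φ i ≠ φ j)
    (hisInt : ∀ i ∈ S, ∀ l ∈ L, ∃ n : ℤ, φ i l = n)
    (hsm : ∀ i ∈ S, ∀ x ∈ B, |φ i x| ≤ 1 / 6) :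
    (S.card : ENNReal) * μ B ≤ 4 * μ F := by
  classical
  set n := S.card with hn
  rcases Nat.eq_zero_or_pos n with h0 | hpos
  · simp [h0]
  set g : E → ℝ := fun x => ∑ i ∈ S, ∑ j ∈ S, Real.cos (2 * Real.pi * (φ i - φ j) x) with hg
  have hgsq : ∀ x, g x = (∑ i ∈ S, Real.cos (2 * Real.pi * φ i x)) ^ 2 + (∑ i ∈ S, Real.sin (2 * Real.pi * φ i x)) ^ 2 := by
    intro x
    rw [hg, pow_two, pow_two, Finset.sum_mul_sum, Finset.sum_mul_sum, ← Finset.sum_add_distrib]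
    refine Finset.sum_congr rfl fun i _ => ?_
    rw [← Finset.sum_add_distrib]
    refine Finset.sum_congr rfl fun j _ => ?_
    rw [LinearMap.sub_apply, mul_sub, Real.cos_sub]
  have hg0 : ∀ x, 0 ≤ g x := fun x => by rw [hgsq]; positivity
  have hgB : ∀ x ∈ B, ((n : ℝ) / 2) ^ 2 ≤ g x := by
    intro x hx
    rw [hgsq]
    have : (n : ℝ) / 2 ≤ ∑ i ∈ S, Real.cos (2 * Real.pi * φ i x) := by
      have : ∑ i ∈ S, (1 / 2 : ℝ) ≤ ∑ i ∈ S, Real.cos (2 * Real.pi * φ i x) := by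
        refine Finset.sum_le_sum fun i hi => ?_
        rw [← Real.cos_pi_div_three, ← Real.cos_abs (2 * Real.pi * φ i x)]
        have h6 := hsm i hi x hx
        apply Real.cos_le_cos_of_nonneg_of_le_pi (abs_nonneg _) (by linarith [Real.pi_pos])
        rw [abs_mul, abs_of_pos (by positivity)]
        nlinarith [Real.pi_pos]
      refine le_trans (le_of_eq ?_) this
      rw [Finset.sum_const, nsmul_eq_mul]; ring
    have h2 : ((n : ℝ) / 2) ^ 2 ≤ (∑ i ∈ S, Real.cos (2 * Real.pi * φ i x)) ^ 2 := by gcongr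
    nlinarith [sq_nonneg (∑ i ∈ S, Real.sin (2 * Real.pi * φ i x))]
  have hcont : ∀ ψ : E →ₗ[ℝ] ℝ, Continuous fun x => Real.cos (2 * Real.pi * ψ x) := by
    intro ψ
    have := ψ.continuous_of_finiteDimensional
    fun_prop
  have hintg : ∀ ψ : E →ₗ[ℝ] ℝ, IntegrableOn (fun x => Real.cos (2 * Real.pi * ψ x)) F μ := by
    intro ψ
    haveI : IsFiniteMeasure (μ.restrict F) := ⟨by simpa using hFf.lt_top⟩
    refine Integrable.of_bound (hcont ψ).aestronglyMeasurable 1 ?_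
    exact Filter.Eventually.of_forall fun x => by simpa using Real.abs_cos_le_one _
  have hgF : ∫ x in F, g x ∂μ = n * (μ F).toReal := by
    rw [hg, integral_finsetSum _ (fun i _ => integrable_finsetSum _ fun j _ => hintg _)]
    have : ∀ i ∈ S, ∫ x in F, ∑ j ∈ S, Real.cos (2 * Real.pi * (φ i - φ j) x) ∂μ = (μ F).toReal := by
      intro i hi
      rw [integral_finsetSum _ (fun j _ => hintg _), Finset.sum_eq_single i]
      · simp [Measure.real]
      · intro j hj hji
        apply integral_cos_fundDom μ L F hF
        · exact sub_ne_zero.2 (hφ i hi j hj hji.symm)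
        · intro l hl
          obtain ⟨a, ha⟩ := hisInt i hi l hl
          obtain ⟨b, hb⟩ := hisInt j hj l hl
          exact ⟨a - b, by rw [LinearMap.sub_apply, ha, hb]; push_cast; ring⟩
      · intro h; exact absurd hi h
    rw [Finset.sum_congr rfl this, Finset.sum_const, nsmul_eq_mul]
  have hgi : IntegrableOn g F μ := integrable_finsetSum _ fun i _ => integrable_finsetSum _ fun j _ => hintg _
  have hlF : ∫⁻ x in F, ENNReal.ofReal (g x) ∂μ = n * μ F := by
    rw [← ofReal_integral_eq_lintegral_ofReal hgi (Filter.Eventually.of_forall hg0), hgF,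
      ENNReal.ofReal_mul (by positivity), ENNReal.ofReal_toReal hFf, ENNReal.ofReal_natCast]
  have hlB : ENNReal.ofReal (((n : ℝ) / 2) ^ 2) * μ B ≤ ∫⁻ x in B, ENNReal.ofReal (g x) ∂μ := by
    rw [← setLIntegral_const]
    exact setLIntegral_mono' hBm fun x hx => ENNReal.ofReal_le_ofReal (hgB x hx)
  have hle := hlB.trans ((setIntegral_le_fundDom μ L F B hF hFm hBm hB _ (by
    intro l x
    congr 1
    rw [hg]
    refine Finset.sum_congr rfl fun i hi => Finset.sum_congr rfl fun j hj => ?_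
    obtain ⟨a, ha⟩ := hisInt i hi l l.2
    obtain ⟨b, hb⟩ := hisInt j hj l l.2
    have : (φ i - φ j) (l +ᵥ x) = (φ i - φ j) x + (a - b : ℤ) := by
      change (φ i - φ j) ((l : E) + x) = _
      rw [map_add, LinearMap.sub_apply, ha, hb]; push_cast; ring
    rw [this, mul_add, mul_comm (2 * Real.pi) ((a - b : ℤ) : ℝ), Real.cos_add_int_mul_two_pi])).trans hlF.le)
  have he : ENNReal.ofReal (((n : ℝ) / 2) ^ 2) = n * (n / 4) := by
    rw [show ((n : ℝ) / 2) ^ 2 = n * (n / 4) by ring, ENNReal.ofReal_mul (by positivity),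
      ENNReal.ofReal_div_of_pos (by norm_num)]
    simp
  rw [he, mul_assoc, ENNReal.mul_le_mul_iff_right (by simpa using hpos.ne') (by simp)] at hle
  calc (n : ENNReal) * μ B = 4 * (n / 4 * μ B) := by
        rw [← mul_assoc, ENNReal.mul_div_cancel (by norm_num) (by norm_num)]
    _ ≤ _ := by gcongr

end

section

open MeasureTheory NumberField NumberField.InfinitePlace NumberField.mixedEmbedding nonZeroDivisors
open scoped NNReal

open scoped Classical in
/-- The trace functional on the mixed space. -/
noncomputable def mixedTr (K : Type*) [Field K] [NumberField K] : mixedSpace K →ₗ[ℝ] ℝ where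
  toFun x := ∑ w, x.1 w + ∑ w, 2 * (x.2 w).re
  map_add' x y := by
    simp only [Prod.fst_add, Pi.add_apply, Prod.snd_add, Complex.add_re, mul_add, Finset.sum_add_distrib]
    ring
  map_smul' c x := by
    simp only [Prod.smul_fst, Pi.smul_apply, smul_eq_mul, Prod.smul_snd, Complex.real_smul,
      Complex.re_ofReal_mul, RingHom.id_apply, mul_add, Finset.mul_sum]
    congr 1
    exact Finset.sum_congr rfl fun _ _ => by ring

theorem trace_eq_sum_places (K : Type*) [Field K] [NumberField K] (x : K) :
    ((Algebra.trace ℚ K x : ℚ) : ℝ) = ∑ w : InfinitePlace K, (mult w : ℝ) * (w.embedding x).re := by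
  classical
  have h := trace_eq_sum_embeddings (K := ℚ) (L := K) ℂ (x := x)
  have h2 := congrArg Complex.re h
  rw [Complex.re_sum] at h2
  have h3 : ((algebraMap ℚ ℂ) ((Algebra.trace ℚ K) x)).re = ((Algebra.trace ℚ K x : ℚ) : ℝ) := by
    simp
  rw [h3] at h2
  rw [h2, ← Fintype.sum_equiv (RingHom.equivRatAlgHom K ℂ) (fun f => (f x).re)
      (fun φ => (φ x).re) fun _ => by simp [RingHom.equivRatAlgHom_apply]]
  rw [← Finset.sum_fiberwise Finset.univ InfinitePlace.mk (fun φ : K →+* ℂ => (φ x).re)]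
  refine Finset.sum_congr rfl fun w _ => ?_
  have : ∀ φ ∈ Finset.univ.filter (fun φ : K →+* ℂ => InfinitePlace.mk φ = w), (φ x).re = (w.embedding x).re := by
    intro φ hφ
    have h := (Finset.mem_filter.mp hφ).2
    rw [← mk_embedding w, mk_eq_iff] at h
    rcases h with h | h
    · rw [h]
    · rw [← h, ComplexEmbedding.conjugate_coe_eq, Complex.conj_re]
  rw [Finset.sum_congr rfl this, Finset.sum_const, card_filter_mk_eq, nsmul_eq_mul]

open scoped Classical in
theorem mixedTr_mixedEmbedding (K : Type*) [Field K] [NumberField K] (x : K) :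
    mixedTr K (mixedEmbedding K x) = ((Algebra.trace ℚ K x : ℚ) : ℝ) := by
  rw [trace_eq_sum_places]
  change ∑ w, (mixedEmbedding K x).1 w + ∑ w, 2 * ((mixedEmbedding K x).2 w).re = _
  rw [← Finset.sum_add_sum_compl (Finset.univ.filter (fun w : InfinitePlace K => IsReal w))]
  congr 1
  · symm
    rw [← Finset.sum_subtype_eq_sum_filter]
    simp only [Finset.subtype_univ]
    refine Finset.sum_congr rfl fun w _ => ?_
    rw [mixedEmbedding_apply_isReal, mult_isReal, Nat.cast_one, one_mul, ← embedding_of_isReal_apply w.2,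
      Complex.ofReal_re]
  · symm
    rw [Finset.compl_filter]
    simp_rw [not_isReal_iff_isComplex]
    rw [← Finset.sum_subtype_eq_sum_filter]
    simp only [Finset.subtype_univ]
    refine Finset.sum_congr rfl fun w _ => ?_
    rw [mixedEmbedding_apply_isComplex, mult_isComplex, Nat.cast_ofNat]

open scoped Classical in
theorem abs_mixedTr_le (K : Type*) [Field K] [NumberField K] (x : mixedSpace K) (r : ℝ)
    (h1 : ∀ w, |x.1 w| ≤ r) (h2 : ∀ w, ‖x.2 w‖ ≤ r) : |mixedTr K x| ≤ Module.finrank ℚ K * r := by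
  change |∑ w, x.1 w + ∑ w, 2 * (x.2 w).re| ≤ _
  have a : |∑ w, x.1 w| ≤ nrRealPlaces K * r := by
    refine (Finset.abs_sum_le_sum_abs _ _).trans ((Finset.sum_le_card_nsmul _ _ r fun w _ => h1 w).trans ?_)
    rw [nsmul_eq_mul, Finset.card_univ, nrRealPlaces]
  have b : |∑ w, 2 * (x.2 w).re| ≤ nrComplexPlaces K * (2 * r) := by
    refine (Finset.abs_sum_le_sum_abs _ _).trans ((Finset.sum_le_card_nsmul _ _ (2 * r) fun w _ => ?_).trans ?_)
    · rw [abs_mul, abs_two]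
      linarith [(Complex.abs_re_le_norm (x.2 w)).trans (h2 w)]
    · rw [nsmul_eq_mul, Finset.card_univ, nrComplexPlaces]
  rw [← card_add_two_mul_card_eq_rank]
  push_cast
  linarith [abs_add_le (∑ w, x.1 w) (∑ w, 2 * (x.2 w).re)]

theorem norm_ge_of_mem_dual (K : Type*) [Field K] [NumberField K] (ξ : K) (h0 : ξ ≠ 0)
    (h : ξ ∈ FractionalIdeal.dual ℤ ℚ (1 : FractionalIdeal (𝓞 K)⁰ K)) :
    1 ≤ |(Algebra.norm ℚ ξ : ℚ)| * |(discr K : ℚ)| := by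
  have hd : ((differentIdeal ℤ (𝓞 K) : Ideal (𝓞 K)) : FractionalIdeal (𝓞 K)⁰ K) =
     (FractionalIdeal.dual ℤ ℚ 1)⁻¹ := coeIdeal_differentIdeal ℤ ℚ K (𝓞 K)
  have hle : FractionalIdeal.spanSingleton (𝓞 K)⁰ ξ * ((differentIdeal ℤ (𝓞 K) : Ideal (𝓞 K)) : FractionalIdeal (𝓞 K)⁰ K) ≤ 1 := by
    rw [hd]
    calc _ ≤ (FractionalIdeal.dual ℤ ℚ (1 : FractionalIdeal (𝓞 K)⁰ K)) * (FractionalIdeal.dual ℤ ℚ 1)⁻¹ := by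
          gcongr
          rwa [FractionalIdeal.spanSingleton_le_iff_mem]
      _ = 1 := mul_inv_cancel₀ (by simp)
  obtain ⟨J, hJ⟩ := FractionalIdeal.le_one_iff_exists_coeIdeal.1 hle
  have hn := congrArg FractionalIdeal.absNorm hJ
  rw [FractionalIdeal.coeIdeal_absNorm, map_mul, FractionalIdeal.absNorm_span_singleton,
    FractionalIdeal.coeIdeal_absNorm, absNorm_differentIdeal K (𝓞 K)] at hn
  have e : (((discr K).natAbs : ℕ) : ℚ) = |(discr K : ℚ)| := by
    rw [Nat.cast_natAbs, Int.cast_abs]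
  rw [← e, ← hn]
  have : J ≠ ⊥ := by
    rintro rfl
    rw [Ideal.absNorm_bot] at hn
    have h1 : Algebra.norm ℚ ξ ≠ 0 := Algebra.norm_ne_zero_iff.2 h0
    have h2 : ((discr K).natAbs : ℚ) ≠ 0 := by simpa using discr_ne_zero K
    have : |(Algebra.norm ℚ ξ : ℚ)| * ((discr K).natAbs : ℚ) ≠ 0 := mul_ne_zero (abs_ne_zero.2 h1) h2
    simp at hn
    rcases hn with hn | hn
    · exact h1 (by simpa using hn)
    · exact discr_ne_zero K hn
  have h3 : Ideal.absNorm J ≠ 0 := by rwa [Ne, Ideal.absNorm_eq_zero_iff]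
  exact_mod_cast Nat.one_le_iff_ne_zero.2 h3

end

section

open MeasureTheory NumberField NumberField.InfinitePlace NumberField.mixedEmbedding nonZeroDivisors
open scoped NNReal

open scoped Classical in
theorem count_box_aux (K : Type*) [Field K] [NumberField K] (S : Finset (𝓞 K)) (Y r : ℝ) (hr : 0 < r)
    (hY : 0 ≤ Y)
    (hS : ∀ γ ∈ S, ∀ w : InfinitePlace K, w (γ : K) ≤ Y)
    (hr1 : (2 * r) ^ (Module.finrank ℚ K) * |(discr K : ℝ)| ≤ 1)
    (hr2 : (Module.finrank ℚ K) * (Y * r) ≤ 1 / 6) :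
    (S.card : ℝ) * r ^ (Module.finrank ℚ K) * √|(discr K : ℝ)| ≤ 4 := by
  set D0 : FractionalIdeal (𝓞 K)⁰ K := FractionalIdeal.dual ℤ ℚ (1 : FractionalIdeal (𝓞 K)⁰ K) with hD0
  have hD0ne : D0 ≠ 0 := by simp [hD0]
  set I : (FractionalIdeal (𝓞 K)⁰ K)ˣ := Units.mk0 D0 hD0ne with hI
  set f : InfinitePlace K → ℝ≥0 := fun _ => r.toNNReal with hf
  set B := convexBodyLT K f with hB
  set F := ZSpan.fundamentalDomain (fractionalIdealLatticeBasis K I) with hF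
  have h_fund := ZSpan.isAddFundamentalDomain' (fractionalIdealLatticeBasis K I) (volume : Measure (mixedSpace K))
  have : Countable (Submodule.span ℤ (Set.range (fractionalIdealLatticeBasis K I))).toAddSubgroup := by
    change Countable (Submodule.span ℤ (Set.range (fractionalIdealLatticeBasis K I)))
    infer_instance
  have memB : ∀ x ∈ B, (∀ w, |x.1 w| < r) ∧ (∀ w, ‖x.2 w‖ < r) := by
    intro x hx
    simp only [hB, Set.mem_prod, Set.mem_pi, Set.mem_univ, Metric.mem_ball, dist_zero_right, forall_true_left] at hx
    have hr' : (r.toNNReal : ℝ) = r := Real.coe_toNNReal r hr.le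
    exact ⟨fun w => (hx.1 w).trans_eq hr', fun w => (hx.2 w).trans_eq hr'⟩
  have key := bessel_count (volume : Measure (mixedSpace K)) _ F B h_fund
    (ZSpan.fundamentalDomain_measurableSet _)
    ((MeasurableSet.univ_pi fun _ => Metric.isOpen_ball.measurableSet).prod
      (MeasurableSet.univ_pi fun _ => Metric.isOpen_ball.measurableSet))
    (ZSpan.fundamentalDomain_isBounded _).measure_lt_top.ne
    (by
      intro x hx y hy hxy
      rw [Submodule.mem_toAddSubgroup, mem_span_fractionalIdealLatticeBasis] at hxy
      obtain ⟨ξ, hξ, hxi⟩ := hxy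
      by_contra hne
      have hξ0 : ξ ≠ 0 := by
        rintro rfl
        rw [map_zero] at hxi
        exact hne (sub_eq_zero.1 hxi.symm)
      have h1 := norm_ge_of_mem_dual K ξ hξ0 hξ
      have hw : ∀ w : InfinitePlace K, w ξ < 2 * r := by
        have : mixedEmbedding K ξ ∈ convexBodyLT K (fun _ => (2 * r).toNNReal) := by
          rw [hxi]
          obtain ⟨a1, a2⟩ := memB x hx
          obtain ⟨b1, b2⟩ := memB y hy
          simp only [Set.mem_prod, Set.mem_pi, Set.mem_univ, Metric.mem_ball, dist_zero_right, forall_true_left, Real.coe_toNNReal (2 * r) (by positivity)]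
          refine ⟨fun w => ?_, fun w => ?_⟩
          · change |x.1 w - y.1 w| < 2 * r
            linarith [abs_sub (x.1 w) (y.1 w), a1 w, b1 w]
          · change ‖x.2 w - y.2 w‖ < 2 * r
            linarith [norm_sub_le (x.2 w) (y.2 w), a2 w, b2 w]
        intro w
        have := (convexBodyLT_mem K _).1 this w
        rwa [Real.coe_toNNReal (2 * r) (by positivity)] at this
      have h2 : |((Algebra.norm ℚ ξ : ℚ) : ℝ)| < (2 * r) ^ (Module.finrank ℚ K) := by
        rw [← Rat.cast_abs, ← prod_eq_abs_norm, ← sum_mult_eq, ← Finset.prod_pow_eq_pow_sum]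
        refine Finset.prod_lt_prod_of_nonempty (fun w _ => ?_) (fun w _ => ?_) Finset.univ_nonempty
        · exact pow_pos (pos_iff.2 hξ0) _
        · exact pow_lt_pow_left₀ (hw w) (apply_nonneg _ _) mult_ne_zero
      have h3 : (1 : ℝ) ≤ |((Algebra.norm ℚ ξ : ℚ) : ℝ)| * |(discr K : ℝ)| := by exact_mod_cast h1
      have h4 : 0 < |(discr K : ℝ)| := abs_pos.2 (by exact_mod_cast discr_ne_zero K)
      nlinarith)
    S (fun γ => mixedTr K ∘ₗ LinearMap.mulLeft ℝ (mixedEmbedding K (γ : K)))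
    (by
      intro γ hγ δ hδ hne heq
      have hk : ((γ : K) - δ) ≠ 0 := by
        rw [sub_ne_zero]; exact fun h => hne (RingOfIntegers.ext h)
      have := LinearMap.congr_fun heq (mixedEmbedding K (((γ : K) - δ)⁻¹))
      simp only [LinearMap.comp_apply, LinearMap.mulLeft_apply, ← map_mul] at this
      rw [← sub_eq_zero, ← map_sub, ← map_sub, ← sub_mul, mul_inv_cancel₀ hk, mixedTr_mixedEmbedding,
        show (1 : K) = algebraMap ℚ K 1 by simp, Algebra.trace_algebraMap] at this
      simp at this
      exact absurd this Module.finrank_pos.ne')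
    (by
      intro γ hγ l hl
      rw [Submodule.mem_toAddSubgroup, mem_span_fractionalIdealLatticeBasis] at hl
      obtain ⟨ξ, hξ, rfl⟩ := hl
      rw [LinearMap.comp_apply, LinearMap.mulLeft_apply, ← map_mul, mixedTr_mixedEmbedding]
      have h1 : ξ ∈ FractionalIdeal.dual ℤ ℚ (1 : FractionalIdeal (𝓞 K)⁰ K) := hξ
      rw [FractionalIdeal.mem_dual (one_ne_zero : (1 : FractionalIdeal (𝓞 K)⁰ K) ≠ 0)] at h1
      obtain ⟨n, hn⟩ := h1 (γ : K) (FractionalIdeal.mem_one_iff _|>.2 ⟨γ, rfl⟩)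
      refine ⟨n, ?_⟩
      rw [Algebra.traceForm_apply, mul_comm] at hn
      rw [← hn]; simp)
    (by
      intro γ hγ x hx
      obtain ⟨a1, a2⟩ := memB x hx
      rw [LinearMap.comp_apply, LinearMap.mulLeft_apply]
      refine (abs_mixedTr_le K _ (Y * r) ?_ ?_).trans hr2
      · intro w
        rw [Prod.fst_mul, Pi.mul_apply, abs_mul, mixedEmbedding_apply_isReal]
        refine mul_le_mul ?_ (a1 w).le (abs_nonneg _) hY
        rw [← Real.norm_eq_abs, norm_embedding_of_isReal]
        exact hS γ hγ w
      · intro w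
        rw [Prod.snd_mul, Pi.mul_apply, norm_mul, mixedEmbedding_apply_isComplex]
        refine mul_le_mul ?_ (a2 w).le (norm_nonneg _) hY
        rw [norm_embedding_eq]
        exact hS γ hγ w)
  rw [hF, volume_fundamentalDomain_fractionalIdealLatticeBasis, volume_fundamentalDomain_latticeBasis,
    hB, convexBodyLT_volume] at key
  have habs : FractionalIdeal.absNorm (I : FractionalIdeal (𝓞 K)⁰ K) * |(discr K : ℚ)| = 1 := by
    have hd : ((differentIdeal ℤ (𝓞 K) : Ideal (𝓞 K)) : FractionalIdeal (𝓞 K)⁰ K) =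
      (FractionalIdeal.dual ℤ ℚ 1)⁻¹ := coeIdeal_differentIdeal ℤ ℚ K (𝓞 K)
    have e : (((discr K).natAbs : ℕ) : ℚ) = |(discr K : ℚ)| := by
      rw [Nat.cast_natAbs, Int.cast_abs]
    rw [← e, ← absNorm_differentIdeal K (𝓞 K), ← FractionalIdeal.coeIdeal_absNorm (K := K), hd, ← map_mul]
    have : (I : FractionalIdeal (𝓞 K)⁰ K) * (FractionalIdeal.dual ℤ ℚ 1)⁻¹ = 1 := mul_inv_cancel₀ hD0ne
    rw [this, FractionalIdeal.absNorm_one]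
  have hΔ : 0 < |(discr K : ℝ)| := abs_pos.2 (by exact_mod_cast discr_ne_zero K)
  have habs' : ((FractionalIdeal.absNorm (I : FractionalIdeal (𝓞 K)⁰ K) : ℚ) : ℝ) = |(discr K : ℝ)|⁻¹ := by
    apply eq_inv_of_mul_eq_one_left
    exact_mod_cast habs
  have hprod : ∏ w, f w ^ w.mult = r.toNNReal ^ (Module.finrank ℚ K) := by
    rw [← sum_mult_eq, ← Finset.prod_pow_eq_pow_sum]
  rw [habs', hprod, ENNReal.coe_pow] at key
  have key2 := ENNReal.toReal_mono (by
    refine ENNReal.mul_ne_top (by simp) (ENNReal.mul_ne_top (by simp) (ENNReal.mul_ne_top ?_ (by simp)))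
    simp) key
  simp only [ENNReal.toReal_mul, ENNReal.toReal_natCast, ENNReal.toReal_pow, ENNReal.toReal_inv,
    ENNReal.toReal_ofNat, ENNReal.coe_toReal, Real.coe_sqrt, coe_nnnorm, Int.norm_eq_abs] at key2
  rw [ENNReal.toReal_ofReal (by positivity), Real.coe_toNNReal r hr.le] at key2
  have hfac : (1 : ℝ) ≤ (convexBodyLTFactor K : ℝ) := by exact_mod_cast one_le_convexBodyLTFactor K
  have h2 : ((2 : ℝ)⁻¹) ^ nrComplexPlaces K ≤ 1 := pow_le_one₀ (by norm_num) (by norm_num)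
  have hs : √|(discr K : ℝ)| * √|(discr K : ℝ)| = |(discr K : ℝ)| := Real.mul_self_sqrt hΔ.le
  have hsp : 0 < √|(discr K : ℝ)| := Real.sqrt_pos.2 hΔ
  have hr' : (r.toNNReal : ℝ) = r := Real.coe_toNNReal r hr.le
  have hrp : 0 < r ^ (Module.finrank ℚ K) := by positivity
  have key3 : (S.card : ℝ) * r ^ (Module.finrank ℚ K) ≤ 4 * (|(discr K : ℝ)|⁻¹ * √|(discr K : ℝ)|) := by
    calc (S.card : ℝ) * r ^ (Module.finrank ℚ K) ≤ S.card * (convexBodyLTFactor K * r ^ (Module.finrank ℚ K)) := by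
          gcongr; nlinarith
      _ ≤ _ := key2
      _ ≤ 4 * (|(discr K : ℝ)|⁻¹ * (1 * √|(discr K : ℝ)|)) := by gcongr
      _ = _ := by ring
  calc _ ≤ 4 * (|(discr K : ℝ)|⁻¹ * √|(discr K : ℝ)|) * √|(discr K : ℝ)| := by gcongr
    _ = 4 * (|(discr K : ℝ)|⁻¹ * (√|(discr K : ℝ)| * √|(discr K : ℝ)|)) := by ring
    _ = 4 := by rw [hs, inv_mul_cancel₀ hΔ.ne', mul_one]

theorem count_box (d : ℕ) (hd : 0 < d) (c : ℝ) (hc : 0 < c) : ∃ C : ℝ, 0 < C ∧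
    ∀ (K : Type) [Field K] [NumberField K], Module.finrank ℚ K = d → ∀ S : Finset (𝓞 K),
    (∀ γ ∈ S, ∀ w : InfinitePlace K, w (γ : K) ≤ c * |(discr K : ℝ)| ^ (1 / (d : ℝ))) →
    (S.card : ℝ) ≤ C * |(discr K : ℝ)| ^ (1 / 2 : ℝ) := by
  have hd' : (0 : ℝ) < d := by exact_mod_cast hd
  set ρ : ℝ := min (1 / 2) (1 / (6 * d * c)) with hρ
  have hρ0 : 0 < ρ := by rw [hρ]; positivity
  refine ⟨4 / ρ ^ d, by positivity, ?_⟩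
  intro K _ _ hK S hS
  have hΔ : 0 < |(discr K : ℝ)| := abs_pos.2 (by exact_mod_cast discr_ne_zero K)
  set M := |(discr K : ℝ)| ^ (1 / (d : ℝ)) with hM
  have hM0 : 0 < M := by positivity
  have hMd : M ^ d = |(discr K : ℝ)| := by
    rw [hM, ← Real.rpow_natCast, ← Real.rpow_mul hΔ.le, one_div_mul_cancel hd'.ne', Real.rpow_one]
  have := count_box_aux K S (c * M) (ρ / M) (by positivity) (by positivity) hS (by
      rw [hK, mul_pow, div_pow, hMd]
      have : (2 * ρ) ^ d ≤ 1 := pow_le_one₀ (by positivity) (by linarith [min_le_left (1/2 : ℝ) (1 / (6 * d * c))])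
      rw [mul_pow] at this
      calc _ = 2 ^ d * ρ ^ d := by field_simp
        _ ≤ 1 := this) (by
      rw [hK]
      have h1 : ρ ≤ 1 / (6 * d * c) := min_le_right _ _
      calc (d : ℝ) * (c * M * (ρ / M)) = d * c * ρ := by field_simp
        _ ≤ d * c * (1 / (6 * d * c)) := by gcongr
        _ = 1 / 6 := by field_simp)
  rw [hK, div_pow, hMd] at this
  rw [← Real.sqrt_eq_rpow, div_mul_eq_mul_div, le_div_iff₀ (by positivity)]
  have hs : √|(discr K : ℝ)| * √|(discr K : ℝ)| = |(discr K : ℝ)| := Real.mul_self_sqrt hΔ.le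
  have hsp : 0 < √|(discr K : ℝ)| := Real.sqrt_pos.2 hΔ
  have h5 : (S.card : ℝ) * (ρ ^ d / |(discr K : ℝ)|) * √|(discr K : ℝ)| * √|(discr K : ℝ)| = S.card * ρ ^ d := by
    rw [mul_assoc, hs]; field_simp
  rw [← h5]
  gcongr

end

section

open MeasureTheory NumberField NumberField.InfinitePlace NumberField.mixedEmbedding nonZeroDivisors
open scoped NNReal

open scoped Classical in
theorem class_rep (K : Type*) [Field K] [NumberField K] (c : ClassGroup (𝓞 K)) (hc : c ^ 2 = 1) :
    ∃ (J : (Ideal (𝓞 K))⁰) (γ : 𝓞 K), γ ≠ 0 ∧ ClassGroup.mk0 J = c ∧ (J : Ideal (𝓞 K)) ^ 2 = Ideal.span {γ} ∧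
      ∀ w : InfinitePlace K, w (γ : K) ≤ 9 * |(discr K : ℝ)| ^ (1 / (Module.finrank ℚ K : ℝ)) := by
  obtain ⟨I0, hI0⟩ := ClassGroup.mk0_surjective c⁻¹
  have hI2 : ClassGroup.mk0 (I0 ^ 2) = 1 := by rw [map_pow, hI0, inv_pow, hc, inv_one]
  rw [ClassGroup.mk0_eq_one_iff] at hI2
  obtain ⟨β, hβ⟩ := hI2
  have hβ' : (I0 : Ideal (𝓞 K)) ^ 2 = Ideal.span {β} := by
    rw [← Ideal.submodule_span_eq, ← hβ]; rfl
  have hI0ne : (I0 : Ideal (𝓞 K)) ≠ ⊥ := nonZeroDivisors.coe_ne_zero I0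
  have hβ0 : β ≠ 0 := by
    rintro rfl
    have : (I0 : Ideal (𝓞 K)) ^ 2 = 0 := by rw [hβ']; simp
    exact hI0ne (pow_eq_zero_iff (two_ne_zero) |>.1 this)
  have hβK : (β : K) ≠ 0 := by simpa using hβ0
  set d := Module.finrank ℚ K with hd
  have hdpos : 0 < d := Module.finrank_pos
  have hd' : (0 : ℝ) < d := by exact_mod_cast hdpos
  have hΔ : 0 < |(discr K : ℝ)| := abs_pos.2 (by exact_mod_cast discr_ne_zero K)
  set B : ℝ := 3 * |(discr K : ℝ)| ^ (1 / (2 * d : ℝ)) with hB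
  have hB0 : 0 < B := by positivity
  have hBd : B ^ d = 3 ^ d * √|(discr K : ℝ)| := by
    rw [hB, mul_pow, ← Real.rpow_natCast (|(discr K : ℝ)| ^ (1 / (2 * d : ℝ))), ← Real.rpow_mul hΔ.le, Real.sqrt_eq_rpow]
    congr 2; field_simp
  have hB2 : B ^ 2 = 9 * |(discr K : ℝ)| ^ (1 / (d : ℝ)) := by
    rw [hB, mul_pow, ← Real.rpow_natCast (|(discr K : ℝ)| ^ (1 / (2 * d : ℝ))), ← Real.rpow_mul hΔ.le]
    congr 1
    · norm_num
    · congr 1; push_cast; field_simp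
  set f : InfinitePlace K → ℝ≥0 := fun w => (B * √(w (β : K))).toNNReal with hf
  have hfw : ∀ w, (f w : ℝ) = B * √(w (β : K)) := fun w => Real.coe_toNNReal _ (by positivity)
  have hN : ((Ideal.absNorm (I0 : Ideal (𝓞 K)) : ℕ) : ℝ) ^ 2 = |((Algebra.norm ℚ (β : K) : ℚ) : ℝ)| := by
    have := congrArg Ideal.absNorm hβ'
    rw [map_pow, Ideal.absNorm_span_singleton] at this
    rw [← Algebra.coe_norm_int]
    have h2 : (((Algebra.norm ℤ β).natAbs : ℕ) : ℝ) = |((Algebra.norm ℤ β : ℤ) : ℝ)| := by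
      rw [Nat.cast_natAbs, Int.cast_abs]
    rw [Rat.cast_intCast, ← h2, ← this]
    push_cast; rfl
  have hprod : ((∏ w, f w ^ mult w : ℝ≥0) : ℝ) = B ^ d * (Ideal.absNorm (I0 : Ideal (𝓞 K)) : ℕ) := by
    push_cast
    simp_rw [hfw, mul_pow, Finset.prod_mul_distrib, Finset.prod_pow_eq_pow_sum, sum_mult_eq]
    rw [← hd]
    congr 1
    rw [← Real.sqrt_sq (Nat.cast_nonneg (Ideal.absNorm (I0 : Ideal (𝓞 K)))), hN, ← Rat.cast_abs, ← prod_eq_abs_norm,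
      eq_comm, Real.sqrt_eq_iff_mul_self_eq (by positivity) (by positivity), ← Finset.prod_mul_distrib]
    refine Finset.prod_congr rfl fun w _ => ?_
    rw [← mul_pow, Real.mul_self_sqrt (by positivity)]
  have hNpos : 0 < ((Ideal.absNorm (I0 : Ideal (𝓞 K)) : ℕ) : ℝ) := by
    have : Ideal.absNorm (I0 : Ideal (𝓞 K)) ≠ 0 := by rwa [Ne, Ideal.absNorm_eq_zero_iff]
    positivity
  have hmb : minkowskiBound K (FractionalIdeal.mk0 K I0) < volume (convexBodyLT K f) := by
    rw [minkowskiBound, volume_fundamentalDomain_fractionalIdealLatticeBasis,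
      volume_fundamentalDomain_latticeBasis, convexBodyLT_volume, FractionalIdeal.coe_mk0,
      FractionalIdeal.coeIdeal_absNorm, mixedEmbedding.finrank, ← hd]
    rw [← ENNReal.toReal_lt_toReal]
    · simp only [ENNReal.toReal_mul, ENNReal.toReal_natCast, ENNReal.toReal_pow, ENNReal.toReal_inv,
        ENNReal.toReal_ofNat, ENNReal.coe_toReal, Real.coe_sqrt, coe_nnnorm, Int.norm_eq_abs]
      rw [hprod, ENNReal.toReal_ofReal (by positivity), hBd]
      have hfac : (1 : ℝ) ≤ (convexBodyLTFactor K : ℝ) := by exact_mod_cast one_le_convexBodyLTFactor K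
      have h2 : ((2 : ℝ)⁻¹) ^ nrComplexPlaces K ≤ 1 := pow_le_one₀ (by norm_num) (by norm_num)
      have hsp : 0 < √|(discr K : ℝ)| := Real.sqrt_pos.2 hΔ
      have h3 : (2 : ℝ) ^ d < 3 ^ d := pow_lt_pow_left₀ (by norm_num) (by norm_num) hdpos.ne'
      rw [Rat.cast_natCast]
      calc _ ≤ ((Ideal.absNorm (I0 : Ideal (𝓞 K)) : ℕ) : ℝ) * (1 * √|(discr K : ℝ)|) * 2 ^ d := by
            gcongr
        _ < ((Ideal.absNorm (I0 : Ideal (𝓞 K)) : ℕ) : ℝ) * (1 * √|(discr K : ℝ)|) * 3 ^ d := by gcongr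
        _ = 1 * (3 ^ d * √|(discr K : ℝ)| * ((Ideal.absNorm (I0 : Ideal (𝓞 K)) : ℕ) : ℝ)) := by ring
        _ ≤ _ := by gcongr
    · refine ENNReal.mul_ne_top (ENNReal.mul_ne_top (by simp) (ENNReal.mul_ne_top (by simp) (by simp))) (by simp)
    · exact ENNReal.mul_ne_top ENNReal.coe_ne_top ENNReal.coe_ne_top
  obtain ⟨a, haI, ha0, haw⟩ := exists_ne_zero_mem_ideal_lt K (FractionalIdeal.mk0 K I0) hmb
  rw [FractionalIdeal.coe_mk0, FractionalIdeal.mem_coeIdeal] at haI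
  obtain ⟨α, hαI, rfl⟩ := haI
  have hα0 : α ≠ 0 := by rintro rfl; simp at ha0
  have hα2 : α ^ 2 ∈ (I0 : Ideal (𝓞 K)) ^ 2 := Ideal.pow_mem_pow hαI 2
  rw [hβ', Ideal.mem_span_singleton] at hα2
  obtain ⟨γ, hγ⟩ := hα2
  obtain ⟨J, hJ⟩ := Ideal.dvd_iff_le.2 ((Ideal.span_singleton_le_iff_mem _).2 hαI)
  have hγ0 : γ ≠ 0 := by rintro rfl; rw [mul_zero] at hγ; exact hα0 (pow_eq_zero_iff two_ne_zero |>.1 hγ)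
  have hJ0 : J ≠ ⊥ := by
    rintro rfl
    rw [Ideal.mul_bot, Ideal.span_singleton_eq_bot] at hJ
    exact hα0 hJ
  have hJ2 : J ^ 2 = Ideal.span {γ} := by
    have h1 : (I0 : Ideal (𝓞 K)) ^ 2 * J ^ 2 = (I0 : Ideal (𝓞 K)) ^ 2 * Ideal.span {γ} := by
      rw [← mul_pow, ← hJ, Ideal.span_singleton_pow, hγ, hβ', Ideal.span_singleton_mul_span_singleton]
    exact mul_left_cancel₀ (pow_ne_zero 2 hI0ne) h1
  refine ⟨⟨J, mem_nonZeroDivisors_of_ne_zero hJ0⟩, γ, hγ0, ?_, hJ2, ?_⟩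
  · have h1 : ClassGroup.mk0 (I0 * ⟨J, mem_nonZeroDivisors_of_ne_zero hJ0⟩) = 1 := by
      rw [ClassGroup.mk0_eq_one_iff]
      refine ⟨⟨α, ?_⟩⟩
      rw [Ideal.submodule_span_eq, hJ]; rfl
    rw [map_mul, hI0, inv_mul_eq_one] at h1
    exact h1.symm
  · intro w
    have h1 : w (α : K) ^ 2 = w (β : K) * w (γ : K) := by
      rw [← map_pow, ← map_mul]; congr 1
      exact_mod_cast congrArg (algebraMap (𝓞 K) K) hγ
    have h2 := haw w
    rw [hfw] at h2
    have hwβ : 0 < w (β : K) := pos_iff.2 hβK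
    have h3 : w (α : K) ^ 2 ≤ B ^ 2 * w (β : K) := by
      calc w (α : K) ^ 2 ≤ (B * √(w (β : K))) ^ 2 := by gcongr
        _ = _ := by rw [mul_pow, Real.sq_sqrt hwβ.le]
    rw [← hB2]
    rw [h1, mul_comm] at h3
    exact le_of_mul_le_mul_right h3 hwβ

end

section

open Polynomial NumberField NumberField.InfinitePlace

theorem nat_sq_of_odd_pow {n m k : ℕ} (hk : Odd k) (h : n ^ k = m ^ 2) : ∃ q, n = q ^ 2 := by
  rcases Nat.eq_zero_or_pos n with rfl | hn
  · exact ⟨0, rfl⟩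
  obtain ⟨j, rfl⟩ := hk
  have h1 : (n ^ j) ^ 2 * n = m ^ 2 := by rw [← h]; ring
  have h2 : n ^ j ∣ m := (Nat.pow_dvd_pow_iff two_ne_zero).1 ⟨n, h1.symm⟩
  obtain ⟨q, rfl⟩ := h2
  refine ⟨q, ?_⟩
  rw [mul_pow] at h1
  exact Nat.eq_of_mul_eq_mul_left (by positivity) h1

theorem abs_norm_sub_int (K : Type*) [Field K] [NumberField K] (γ : 𝓞 K) (t : ℤ) :
    (Algebra.norm ℤ (γ - (t : 𝓞 K))).natAbs = ((minpoly ℤ γ).eval t).natAbs ^ (Module.finrank ℚ K / (minpoly ℤ γ).natDegree) := by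
  have hisInt : IsIntegral ℤ γ := RingOfIntegers.isIntegral γ
  have hmin : minpoly ℚ (γ : K) = (minpoly ℤ γ).map (algebraMap ℤ ℚ) :=
    minpoly.isIntegrallyClosed_eq_field_fractions ℚ K hisInt
  set x : K := (γ : K) - algebraMap ℚ K (t : ℚ) with hx
  have hxint : IsIntegral ℚ x := Algebra.IsIntegral.isIntegral x
  have hmx : minpoly ℚ x = (minpoly ℚ (γ : K)).comp (X + C (t : ℚ)) := minpoly.sub_algebraMap _ _
  have hdeg : (minpoly ℚ x).natDegree = (minpoly ℤ γ).natDegree := by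
    rw [hmx, natDegree_comp, natDegree_X_add_C, mul_one, hmin, (minpoly.monic hisInt).natDegree_map]
  have hk : Module.finrank ℚ K / (minpoly ℤ γ).natDegree = Module.finrank (IntermediateField.adjoin ℚ {x}) K := by
    rw [← hdeg, ← IntermediateField.adjoin.finrank hxint,
      ← Module.finrank_mul_finrank ℚ (IntermediateField.adjoin ℚ {x}) K]
    exact Nat.mul_div_cancel_left _ Module.finrank_pos
  have hN : |(Algebra.norm ℚ x : ℚ)| = |(((minpoly ℤ γ).eval t : ℤ) : ℚ)| ^ (Module.finrank ℚ K / (minpoly ℤ γ).natDegree) := by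
    rw [Algebra.norm_eq_norm_adjoin ℚ x, hk, abs_pow]
    congr 1
    have := Algebra.PowerBasis.norm_gen_eq_coeff_zero_minpoly (IntermediateField.adjoin.powerBasis hxint)
    rw [IntermediateField.adjoin.powerBasis_gen] at this
    rw [this, abs_mul, abs_pow, abs_neg, abs_one, one_pow, one_mul, IntermediateField.minpoly_gen, hmx,
      coeff_zero_eq_eval_zero, eval_comp, hmin]
    simp only [eval_add, eval_X, eval_C, zero_add]
    congr 1
    have := Polynomial.eval_map_apply (algebraMap ℤ ℚ) (p := minpoly ℤ γ) t
    simpa using this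
  have hc : ((Algebra.norm ℤ (γ - (t : 𝓞 K)) : ℤ) : ℚ) = Algebra.norm ℚ x := by
    rw [Algebra.coe_norm_int]; congr 1; simp [hx]
  rw [← hc] at hN
  have : (((Algebra.norm ℤ (γ - (t : 𝓞 K))).natAbs : ℕ) : ℚ) = ((((minpoly ℤ γ).eval t).natAbs : ℕ) : ℚ) ^ (Module.finrank ℚ K / (minpoly ℤ γ).natDegree) := by
    rw [Nat.cast_natAbs, Nat.cast_natAbs, Int.cast_abs, Int.cast_abs]; exact hN
  exact_mod_cast this

theorem norm_deriv_bound (K : Type*) [Field K] [NumberField K] (γ : 𝓞 K) (X : ℝ) (hX : 1 ≤ 2 * X)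
    (hγ : ∀ w : InfinitePlace K, w (γ : K) ≤ X) :
    |((Algebra.norm ℤ (aeval γ (derivative (minpoly ℤ γ))) : ℤ) : ℝ)| ≤ (2 * X) ^ (Module.finrank ℚ K * Module.finrank ℚ K) := by
  classical
  have hisInt : IsIntegral ℤ γ := RingOfIntegers.isIntegral γ
  have hmin : minpoly ℚ (γ : K) = (minpoly ℤ γ).map (algebraMap ℤ ℚ) :=
    minpoly.isIntegrallyClosed_eq_field_fractions ℚ K hisInt
  set g := minpoly ℤ γ with hg
  have hdeg : g.natDegree ≤ Module.finrank ℚ K := by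
    have := minpoly.natDegree_le (A := ℚ) (γ : K)
    rwa [hmin, (minpoly.monic hisInt).natDegree_map] at this
  have hw : ∀ w : InfinitePlace K, w ((aeval γ (derivative g) : 𝓞 K) : K) ≤ (2 * X) ^ (Module.finrank ℚ K) := by
    intro w
    rw [← norm_embedding_eq]
    set σ := w.embedding
    set G : ℂ[X] := g.map (algebraMap ℤ ℂ) with hG
    have hGm : G.Monic := (minpoly.monic hisInt).map _
    have h1 : σ ((aeval γ (derivative g) : 𝓞 K) : K) = (derivative G).eval (σ γ) := by
      rw [hG, derivative_map, eval_map]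
      have : σ ((aeval γ (derivative g) : 𝓞 K) : K) = (σ.comp (algebraMap (𝓞 K) K)) (aeval γ (derivative g)) := rfl
      rw [this, aeval_def, hom_eval₂]
      congr 1
      exact RingHom.ext_int _ _
    have hroots : ∀ β ∈ G.roots, ‖β‖ ≤ X := by
      intro β hβ
      have hβ2 : β ∈ (minpoly ℚ (γ : K)).rootSet ℂ := by
        rw [mem_rootSet']
        constructor
        · rw [hmin, map_map]; exact ((minpoly.monic hisInt).map _).ne_zero
        · have := (mem_roots'.1 hβ).2
          rw [IsRoot.def, hG, eval_map] at this
          rw [hmin, aeval_def, eval₂_map]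
          convert this using 2
          exact RingHom.ext_int _ _
      rw [← NumberField.Embeddings.range_eval_eq_rootSet_minpoly] at hβ2
      obtain ⟨φ, rfl⟩ := hβ2
      have := hγ (InfinitePlace.mk φ)
      rwa [InfinitePlace.apply] at this
    have hroot : σ γ ∈ G.roots := by
      rw [mem_roots hGm.ne_zero, IsRoot.def, hG, eval_map]
      have : eval₂ (algebraMap ℤ ℂ) (σ γ) g = (σ.comp (algebraMap (𝓞 K) K)) (aeval γ g) := by
        rw [aeval_def, hom_eval₂]
        congr 1
        exact RingHom.ext_int _ _
      rw [this, hg, minpoly.aeval, map_zero]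
    rw [h1, (IsAlgClosed.splits G).eval_root_derivative hGm hroot]
    have hbd : ∀ s : Multiset ℂ, (∀ β ∈ s, ‖β‖ ≤ X) → ‖(s.map (σ γ - ·)).prod‖ ≤ (2 * X) ^ s.card := by
      intro s
      induction s using Multiset.induction_on with
      | empty => simp
      | cons a s ih =>
        intro h
        rw [Multiset.map_cons, Multiset.prod_cons, norm_mul, Multiset.card_cons, pow_succ, mul_comm]
        refine mul_le_mul (ih fun β hβ => h β (Multiset.mem_cons_of_mem hβ)) ?_ (norm_nonneg _) (by positivity)
        refine (norm_sub_le _ _).trans ?_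
        linarith [h a (Multiset.mem_cons_self a s), hroots _ hroot]
    refine (hbd _ fun β hβ => hroots β (Multiset.mem_of_mem_erase hβ)).trans ?_
    refine pow_le_pow_right₀ hX ?_
    refine (Multiset.card_le_card (Multiset.erase_le _ _)).trans ((card_roots' _).trans ?_)
    rw [hG, (minpoly.monic hisInt).natDegree_map]
    exact hdeg
  have h2 : |((Algebra.norm ℤ (aeval γ (derivative g)) : ℤ) : ℝ)| = ∏ w : InfinitePlace K, w ((aeval γ (derivative g) : 𝓞 K) : K) ^ mult w := by
    rw [prod_eq_abs_norm, ← Algebra.coe_norm_int]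
    push_cast; rfl
  rw [h2]
  calc _ ≤ ∏ w : InfinitePlace K, ((2 * X) ^ (Module.finrank ℚ K)) ^ mult w := by
        refine Finset.prod_le_prod (fun w _ => by positivity) fun w _ => ?_
        gcongr
        exact hw w
    _ = _ := by rw [Finset.prod_pow_eq_pow_sum, sum_mult_eq, ← pow_mul]

theorem not_sq_mod_of_not_dvd (K : Type*) [Field K] [NumberField K] (γ : 𝓞 K) (p : ℕ) [Fact p.Prime]
    (hp : ¬ (p : ℤ) ∣ Algebra.norm ℤ (aeval γ (derivative (minpoly ℤ γ)))) :
    ¬ ∃ (a : ZMod p) (h : (ZMod p)[X]), (minpoly ℤ γ).map (Int.castRingHom (ZMod p)) = C a * h ^ 2 := by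
  rintro ⟨a, h, e⟩
  apply hp
  set g := minpoly ℤ γ with hg
  obtain ⟨A, rfl⟩ := ZMod.intCast_surjective a
  obtain ⟨H, rfl⟩ := Polynomial.map_surjective (Int.castRingHom (ZMod p)) ZMod.intCast_surjective h
  have h0 : C (p : ℤ) ∣ g - C A * H ^ 2 := by
    rw [C_dvd_iff_dvd_coeff]
    intro i
    rw [← ZMod.intCast_zmod_eq_zero_iff_dvd]
    have : (g - C A * H ^ 2).map (Int.castRingHom (ZMod p)) = 0 := by
      rw [Polynomial.map_sub, e, Polynomial.map_mul, Polynomial.map_pow, map_C]; simp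
    have := congrArg (fun q => q.coeff i) this
    simp only [coeff_map, coeff_zero] at this
    exact this
  obtain ⟨R, hR⟩ := h0
  have hgR : g = C A * H ^ 2 + C (p : ℤ) * R := by rw [← hR]; ring
  have hz : aeval γ g = 0 := minpoly.aeval _ _
  have e1 : (A : 𝓞 K) * (aeval γ H) ^ 2 + (p : 𝓞 K) * aeval γ R = 0 := by
    rw [← hz, hgR]; simp
  have e2 : aeval γ (derivative g) = 2 * (A : 𝓞 K) * aeval γ H * aeval γ (derivative H) + (p : 𝓞 K) * aeval γ (derivative R) := by
    rw [hgR]; simp [derivative_pow, map_ofNat]; ring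
  have e3 : (p : 𝓞 K) ∣ (aeval γ (derivative g)) ^ 2 := by
    refine ⟨-4 * A * (aeval γ (derivative H)) ^ 2 * aeval γ R + 4 * (A : 𝓞 K) * aeval γ H * aeval γ (derivative H) * aeval γ (derivative R) + p * (aeval γ (derivative R)) ^ 2, ?_⟩
    rw [e2]
    linear_combination (4 * A * (aeval γ (derivative H)) ^ 2) * e1
  have e4 := map_dvd (Algebra.norm ℤ) e3
  rw [map_pow] at e4
  have hpp : Prime (p : ℤ) := Nat.prime_iff_prime_int.1 Fact.out
  have e5 : (p : ℤ) ∣ Algebra.norm ℤ (p : 𝓞 K) := by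
    have : (p : 𝓞 K) = algebraMap ℤ (𝓞 K) p := by simp
    rw [this, Algebra.norm_algebraMap]
    exact dvd_pow_self _ (by rw [RingOfIntegers.rank]; exact Module.finrank_pos.ne')
  exact hpp.dvd_of_dvd_pow (e5.trans e4)

theorem norm_deriv_ne_zero (K : Type*) [Field K] [NumberField K] (γ : 𝓞 K) :
    Algebra.norm ℤ (aeval γ (derivative (minpoly ℤ γ))) ≠ 0 := by
  rw [Ne, Algebra.norm_eq_zero_iff]
  intro h
  have hisInt : IsIntegral ℤ γ := RingOfIntegers.isIntegral γ
  have hmin : minpoly ℚ (γ : K) = (minpoly ℤ γ).map (algebraMap ℤ ℚ) :=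
    minpoly.isIntegrallyClosed_eq_field_fractions ℚ K hisInt
  have hsep : (minpoly ℚ (γ : K)).Separable := Algebra.IsSeparable.isSeparable ℚ (γ : K)
  have := hsep.aeval_derivative_ne_zero (minpoly.aeval ℚ (γ : K))
  apply this
  rw [hmin, derivative_map, aeval_map_algebraMap]
  have h2 := congrArg (algebraMap (𝓞 K) K) h
  rwa [map_zero, ← aeval_algebraMap_apply] at h2

theorem square_values_bound (m : ℕ) (A : ℝ) : ∃ C : ℝ, 0 < C ∧
    ∀ (f : ℤ[X]) (T : Finset ℤ) (N : ℝ) (D : ℤ) (L : ℝ), f.natDegree ≤ m → 1 ≤ N → 1 ≤ L → D ≠ 0 →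
    Real.log |(D:ℝ)| ≤ A * L →
    (∀ s ∈ T, ∀ t ∈ T, |(s : ℝ) - t| ≤ N) →
    (∀ t ∈ T, ∃ q : ℤ, f.eval t = q ^ 2) →
    (∀ p : ℕ, p.Prime → ¬ (p : ℤ) ∣ D → ¬ ∃ (a : ZMod p) (h : (ZMod p)[X]), f.map (Int.castRingHom (ZMod p)) = Polynomial.C a * h ^ 2) →
    (T.card : ℝ) ≤ C * (√N * L) := by
  obtain ⟨C, hC, h⟩ := sieve_main (7 * m + 7) A (by positivity)
  refine ⟨C, hC, ?_⟩
  intro f T N D L hf hN hL hD hlog hT hsq hp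
  refine h T N D L hN hL hD hlog hT ?_
  intro p pp hpD
  have : Fact p.Prime := ⟨pp⟩
  refine le_trans ?_ (stepanov ((natDegree_map_le).trans hf) (hp p pp hpD))
  norm_cast
  refine Finset.card_le_card ?_
  intro x hx
  obtain ⟨t, ht, rfl⟩ := Finset.mem_image.1 hx
  rw [Finset.mem_filter]
  refine ⟨Finset.mem_univ _, ?_⟩
  obtain ⟨q, hq⟩ := hsq t ht
  have := Polynomial.eval_map_apply (Int.castRingHom (ZMod p)) (p := f) t
  simp only [Int.coe_castRingHom] at this
  rw [this, hq]
  exact ⟨q, by push_cast; ring⟩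

theorem line_bound (d : ℕ) (A : ℝ) : ∃ C : ℝ, 0 < C ∧
    ∀ (K : Type) [Field K] [NumberField K], Module.finrank ℚ K = d → ∀ (γ : 𝓞 K) (T : Finset ℤ) (N X L : ℝ),
    1 ≤ N → 1 ≤ L → 1 ≤ 2 * X → (Odd d ∨ Real.log (2 * X) ≤ A * L) → (∀ w : InfinitePlace K, w (γ : K) ≤ X) →
    (∀ s ∈ T, ∀ t ∈ T, |(s : ℝ) - t| ≤ N) →
    (∀ t ∈ T, ∃ J : Ideal (𝓞 K), J ^ 2 = Ideal.span {γ - (t : 𝓞 K)}) →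
    Odd (d / (minpoly ℤ γ).natDegree) →
    (T.card : ℝ) ≤ C * (√N * L) := by
  obtain ⟨C, hC, h⟩ := square_values_bound d (d * d * |A|)
  refine ⟨2 * C, by positivity, ?_⟩
  intro K _ _ hK γ T N X L hN hL hX hA hγ hT hJ hodd
  have hisInt : IsIntegral ℤ γ := RingOfIntegers.isIntegral γ
  have hmin : minpoly ℚ (γ : K) = (minpoly ℤ γ).map (algebraMap ℤ ℚ) :=
    minpoly.isIntegrallyClosed_eq_field_fractions ℚ K hisInt
  set g := minpoly ℤ γ with hg
  have hgm : g.Monic := minpoly.monic hisInt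
  have hdeg : g.natDegree ≤ d := by
    have := minpoly.natDegree_le (A := ℚ) (γ : K)
    rwa [hmin, (minpoly.monic hisInt).natDegree_map, hK] at this
  have hdvd : g.natDegree ∣ d := by
    have := minpoly.degree_dvd (K := ℚ) (Algebra.IsIntegral.isIntegral (γ : K))
    rwa [hmin, (minpoly.monic hisInt).natDegree_map, hK] at this
  obtain ⟨D, hD0, hDlog, hDp⟩ : ∃ D : ℤ, D ≠ 0 ∧ Real.log |(D : ℝ)| ≤ (d * d * |A|) * L ∧
      ∀ p : ℕ, p.Prime → ¬ (p : ℤ) ∣ D → ¬ ∃ (a : ZMod p) (h : (ZMod p)[X]), g.map (Int.castRingHom (ZMod p)) = Polynomial.C a * h ^ 2 := by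
    rcases hA with hA | hA
    · refine ⟨1, one_ne_zero, by simp; positivity, ?_⟩
      rintro p pp - ⟨a, q, e⟩
      have : Fact p.Prime := ⟨pp⟩
      have h1 := congrArg natDegree e
      rw [hgm.natDegree_map] at h1
      have h2 : a ≠ 0 := by
        rintro rfl
        rw [C_0, zero_mul] at e
        exact (hgm.map (Int.castRingHom (ZMod p))).ne_zero e
      rw [natDegree_C_mul h2, natDegree_pow] at h1
      have h3 : Odd g.natDegree := Odd.of_dvd_nat hA hdvd
      rw [h1] at h3
      exact (Nat.not_odd_iff_even.2 (even_two_mul _)) h3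
    · refine ⟨_, norm_deriv_ne_zero K γ, ?_, fun p pp hp => ?_⟩
      · have h1 := norm_deriv_bound K γ X hX hγ
        have h0 : (0 : ℝ) < |((Algebra.norm ℤ (aeval γ (derivative (minpoly ℤ γ))) : ℤ) : ℝ)| :=
          abs_pos.2 (by exact_mod_cast norm_deriv_ne_zero K γ)
        have h2 := Real.log_le_log h0 h1
        rw [Real.log_pow, hK] at h2
        refine h2.trans ?_
        push_cast
        have h3 : Real.log (2 * X) ≤ |A| * L := hA.trans (by gcongr; exact le_abs_self A)
        calc (d * d : ℝ) * Real.log (2 * X) ≤ d * d * (|A| * L) := by gcongr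
          _ = _ := by ring
      · have : Fact p.Prime := ⟨pp⟩
        exact not_sq_mod_of_not_dvd K γ p hp
  have hval : ∀ t ∈ T, (∃ q : ℤ, g.eval t = q ^ 2) ∨ (∃ q : ℤ, (-g).eval t = q ^ 2) := by
    intro t ht
    obtain ⟨J, hJt⟩ := hJ t ht
    have h1 := congrArg Ideal.absNorm hJt
    rw [map_pow, Ideal.absNorm_span_singleton, abs_norm_sub_int, hK] at h1
    obtain ⟨q, hq⟩ := nat_sq_of_odd_pow hodd h1.symm
    rcases Int.natAbs_eq (g.eval t) with h2 | h2
    · left; exact ⟨q, by rw [h2, hq]; push_cast; ring⟩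
    · right; exact ⟨q, by rw [eval_neg, h2, hq]; push_cast; ring⟩
  classical
  have hDp' : ∀ p : ℕ, p.Prime → ¬ (p : ℤ) ∣ D → ¬ ∃ (a : ZMod p) (h : (ZMod p)[X]), (-g).map (Int.castRingHom (ZMod p)) = Polynomial.C a * h ^ 2 := by
    rintro p pp hpD ⟨a, q, e⟩
    refine hDp p pp hpD ⟨-a, q, ?_⟩
    rw [Polynomial.map_neg] at e
    rw [C_neg, neg_mul, ← e, neg_neg]
  have b1 := h g (T.filter fun t => ∃ q : ℤ, g.eval t = q ^ 2) N D L hdeg hN hL hD0 hDlog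
    (fun s hs t ht => hT s (Finset.mem_filter.1 hs).1 t (Finset.mem_filter.1 ht).1)
    (fun t ht => (Finset.mem_filter.1 ht).2) hDp
  have b2 := h (-g) (T.filter fun t => ∃ q : ℤ, (-g).eval t = q ^ 2) N D L (by rwa [natDegree_neg]) hN hL hD0 hDlog
    (fun s hs t ht => hT s (Finset.mem_filter.1 hs).1 t (Finset.mem_filter.1 ht).1)
    (fun t ht => (Finset.mem_filter.1 ht).2) hDp'
  have hu : T ⊆ (T.filter fun t => ∃ q : ℤ, g.eval t = q ^ 2) ∪ (T.filter fun t => ∃ q : ℤ, (-g).eval t = q ^ 2) := by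
    intro t ht
    rw [Finset.mem_union, Finset.mem_filter, Finset.mem_filter]
    rcases hval t ht with h | h
    · exact Or.inl ⟨ht, h⟩
    · exact Or.inr ⟨ht, h⟩
  have hc := (Finset.card_le_card hu).trans (Finset.card_union_le _ _)
  have hc' : (T.card : ℝ) ≤ ((T.filter fun t => ∃ q : ℤ, g.eval t = q ^ 2).card : ℝ) + ((T.filter fun t => ∃ q : ℤ, (-g).eval t = q ^ 2).card : ℝ) := by
    exact_mod_cast hc
  linarith

end

section

open NumberField NumberField.InfinitePlace

theorem place_intCast {K : Type*} [Field K] [NumberField K] (w : InfinitePlace K) (t : ℤ) :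
    w ((t : 𝓞 K) : K) = |(t : ℝ)| := by
  rw [← norm_embedding_eq]
  simp

theorem one_le_abs_discr (K : Type*) [Field K] [NumberField K] : 1 ≤ |(discr K : ℝ)| := by
  have := Int.one_le_abs (discr_ne_zero K)
  exact_mod_cast this

theorem odd_part (d : ℕ) (hd : 0 < d) : ∃ C : ℝ, 0 < C ∧
    ∀ (K : Type) [Field K] [NumberField K], Module.finrank ℚ K = d → ∀ (S : Finset (𝓞 K)) (L : ℝ),
      1 ≤ L → (Odd d ∨ Real.log |(discr K : ℝ)| ≤ L) →
      (∀ γ ∈ S, ∀ w : InfinitePlace K, w (γ : K) ≤ 9 * |(discr K : ℝ)| ^ (1 / (d : ℝ))) →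
      (∀ γ ∈ S, ∃ J : Ideal (𝓞 K), J ^ 2 = Ideal.span {γ}) →
      (∀ γ ∈ S, Odd (d / (minpoly ℤ γ).natDegree)) →
      (S.card : ℝ) ≤ C * |(discr K : ℝ)| ^ ((1 : ℝ) / 2 - 1 / (2 * (d : ℝ))) * L := by
  obtain ⟨C1, hC1, h1⟩ := count_box d hd 18 (by norm_num)
  obtain ⟨C2, hC2, h2⟩ := line_bound d (Real.log 18 + 1)
  refine ⟨C2 * 5 * C1, by positivity, ?_⟩
  intro K _ _ hK S L hL hA hbox hJ hodd
  classical
  set D : ℝ := |(discr K : ℝ)| with hD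
  have hD1 : 1 ≤ D := one_le_abs_discr K
  have hD0 : 0 < D := by linarith
  set Y : ℝ := D ^ (1 / (d : ℝ)) with hY
  have hY1 : 1 ≤ Y := Real.one_le_rpow hD1 (by positivity)
  have hd1 : (1 : ℝ) ≤ d := by exact_mod_cast hd
  let q : 𝓞 K → 𝓞 K ⧸ (AddSubgroup.zmultiples (1 : 𝓞 K)) := QuotientAddGroup.mk
  have hq : ∀ x y, q x = q y ↔ ∃ t : ℤ, y = x + t := by
    intro x y
    rw [QuotientAddGroup.eq, AddSubgroup.mem_zmultiples_iff]
    constructor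
    · rintro ⟨t, ht⟩
      refine ⟨t, ?_⟩
      rw [zsmul_one] at ht
      rw [ht]; ring
    · rintro ⟨t, rfl⟩
      exact ⟨t, by rw [zsmul_one]; ring⟩
  have w0 : InfinitePlace K := Classical.arbitrary _
  -- fibre bound
  have hfib : ∀ r ∈ S.image q, (S.filter fun x => q x = r).card ≤ ⌊C2 * (√(18 * Y) * L)⌋₊ := by
    intro r hr
    obtain ⟨g0, hg0, rfl⟩ := Finset.mem_image.1 hr
    have ht : ∀ x : 𝓞 K, ∃ t : ℤ, q x = q g0 → x = g0 - t := by
      intro x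
      by_cases hx : q x = q g0
      · obtain ⟨t, ht⟩ := (hq x g0).1 hx
        exact ⟨t, fun _ => by rw [ht]; ring⟩
      · exact ⟨0, fun h => absurd h hx⟩
    choose t ht using ht
    have hinj : Set.InjOn t (S.filter fun x => q x = q g0 : Finset (𝓞 K)) := by
      intro x hx y hy e
      rw [ht x (Finset.mem_filter.1 hx).2, ht y (Finset.mem_filter.1 hy).2, e]
    rw [← Finset.card_image_of_injOn hinj]
    apply Nat.le_floor
    refine h2 K hK g0 _ (18 * Y) (9 * Y) L (by linarith) hL (by linarith) ?_ (hbox g0 hg0) ?_ ?_ (hodd g0 hg0)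
    · refine hA.imp_right fun h => ?_
      have e1 : 2 * (9 * Y) = 18 * Y := by ring
      rw [e1, Real.log_mul (by norm_num) (by positivity), hY, Real.log_rpow hD0]
      have h18 : 0 ≤ Real.log 18 := Real.log_nonneg (by norm_num)
      have hlD : 0 ≤ Real.log D := Real.log_nonneg hD1
      have : 1 / (d : ℝ) * Real.log D ≤ 1 * Real.log D := by
        gcongr
        rw [div_le_one (by linarith)]; exact hd1
      nlinarith
    · intro s hs s' hs'
      obtain ⟨x, hx, rfl⟩ := Finset.mem_image.1 hs
      obtain ⟨y, hy, rfl⟩ := Finset.mem_image.1 hs'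
      have ex := ht x (Finset.mem_filter.1 hx).2
      have ey := ht y (Finset.mem_filter.1 hy).2
      have e : (((t x - t y : ℤ) : 𝓞 K) : K) = (y : K) - (x : K) := by
        rw [← map_sub]; congr 1
        push_cast
        linear_combination ex - ey
      have e2 := place_intCast w0 (t x - t y)
      rw [e] at e2
      push_cast at e2
      rw [← e2, ← norm_embedding_eq, map_sub]
      refine (norm_sub_le _ _).trans ?_
      rw [norm_embedding_eq, norm_embedding_eq]
      linarith [hbox x (Finset.mem_filter.1 hx).1 w0, hbox y (Finset.mem_filter.1 hy).1 w0]
    · intro s hs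
      obtain ⟨x, hx, rfl⟩ := Finset.mem_image.1 hs
      rw [← ht x (Finset.mem_filter.1 hx).2]
      exact hJ x (Finset.mem_filter.1 hx).1
  have hS := Finset.card_le_mul_card_image (f := q) S _ hfib
  -- number of lines
  have hrep : ∀ r : 𝓞 K ⧸ (AddSubgroup.zmultiples (1 : 𝓞 K)), ∃ x : 𝓞 K, r ∈ S.image q → x ∈ S ∧ q x = r := by
    intro r
    by_cases hr : r ∈ S.image q
    · obtain ⟨x, hx, e⟩ := Finset.mem_image.1 hr
      exact ⟨x, fun _ => ⟨hx, e⟩⟩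
    · exact ⟨0, fun h => absurd h hr⟩
  choose ρ hρ using hrep
  have hlines : ((S.image q).card : ℝ) * Y ≤ C1 * D ^ (1 / 2 : ℝ) := by
    let F : (𝓞 K ⧸ (AddSubgroup.zmultiples (1 : 𝓞 K))) × ℕ → 𝓞 K := fun p => ρ p.1 + (p.2 : ℤ)
    have hFi : Set.InjOn F (S.image q ×ˢ Finset.range (⌊9 * Y⌋₊ + 1) : Finset _) := by
      rintro ⟨r, a⟩ ha ⟨r', b⟩ hb e
      have ha' := (Finset.mem_product.1 ha).1
      have hb' := (Finset.mem_product.1 hb).1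
      simp only at ha' hb'
      have hqF : ∀ p : (𝓞 K ⧸ (AddSubgroup.zmultiples (1 : 𝓞 K))) × ℕ, p.1 ∈ S.image q → q (F p) = p.1 := by
        intro p hp
        conv_rhs => rw [← (hρ p.1 hp).2]
        exact ((hq _ _).2 ⟨(p.2 : ℤ), rfl⟩).symm
      have er : r = r' := by
        have := congrArg q e
        rwa [hqF _ ha', hqF _ hb'] at this
      subst er
      have : (a : 𝓞 K) = (b : 𝓞 K) := by
        have : ρ r + ((a : ℤ) : 𝓞 K) = ρ r + ((b : ℤ) : 𝓞 K) := e
        simpa using this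
      rw [Nat.cast_inj.1 this]
    have hc := h1 K hK ((S.image q ×ˢ Finset.range (⌊9 * Y⌋₊ + 1)).image F) ?_
    · rw [Finset.card_image_of_injOn hFi, Finset.card_product, Finset.card_range] at hc
      push_cast at hc
      refine le_trans ?_ hc
      gcongr
      linarith [(Nat.lt_floor_add_one (9 * Y)).le]
    · intro x hx w
      obtain ⟨p, hp, rfl⟩ := Finset.mem_image.1 hx
      obtain ⟨hp1, hp2⟩ := Finset.mem_product.1 hp
      have b1 := hbox _ (hρ p.1 hp1).1 w
      have b2 := place_intCast w (p.2 : ℤ)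
      have b3 : ((p.2 : ℤ) : ℝ) ≤ 9 * Y := by
        have : p.2 ≤ ⌊9 * Y⌋₊ := Nat.lt_succ_iff.1 (Finset.mem_range.1 hp2)
        push_cast
        exact (Nat.cast_le.2 this).trans (Nat.floor_le (by positivity))
      rw [abs_of_nonneg (by positivity)] at b2
      have : w ((F p : 𝓞 K) : K) ≤ w ((ρ p.1 : 𝓞 K) : K) + w (((p.2 : ℤ) : 𝓞 K) : K) := by
        have e : ((F p : 𝓞 K) : K) = ((ρ p.1 : 𝓞 K) : K) + (((p.2 : ℤ) : 𝓞 K) : K) := by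
          rw [← map_add]
        rw [e, ← norm_embedding_eq, map_add]
        refine (norm_add_le _ _).trans ?_
        rw [norm_embedding_eq, norm_embedding_eq]
      rw [← hD, ← hY] at *
      linarith
  have hYs : √Y * √Y = Y := Real.mul_self_sqrt (by linarith)
  have hYp : 0 < √Y := Real.sqrt_pos.2 (by linarith)
  have hfin : D ^ ((1 : ℝ) / 2 - 1 / (2 * (d : ℝ))) = D ^ (1 / 2 : ℝ) / √Y := by
    rw [Real.rpow_sub hD0, Real.sqrt_eq_rpow, hY, ← Real.rpow_mul hD0.le]
    congr 2
    field_simp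
  have h18 : √(18 * Y) ≤ 5 * √Y := by
    rw [Real.sqrt_mul (by norm_num)]
    gcongr
    rw [Real.sqrt_le_left (by norm_num)]; norm_num
  have hS' : (S.card : ℝ) ≤ (C2 * (5 * √Y * L)) * (S.image q).card := by
    have : (S.card : ℝ) ≤ (⌊C2 * (√(18 * Y) * L)⌋₊ : ℝ) * (S.image q).card := by exact_mod_cast hS
    refine this.trans ?_
    gcongr
    refine (Nat.floor_le (by positivity)).trans ?_
    gcongr
  refine hS'.trans ?_
  rw [hfin]
  have : C2 * (5 * √Y * L) * ((S.image q).card : ℝ) = (C2 * 5 * L / √Y) * ((S.image q).card * Y) := by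
    rw [← hYs]; field_simp; simp
  rw [this]
  calc (C2 * 5 * L / √Y) * ((S.image q).card * Y) ≤ (C2 * 5 * L / √Y) * (C1 * D ^ (1 / 2 : ℝ)) := by gcongr
    _ = _ := by ring

end

section

open NumberField Polynomial UniqueFactorizationMonoid

theorem mem_of_dvd_absNorm {F : Type*} [Field F] [NumberField F] (v : Ideal (𝓞 F)) [v.IsMaximal]
    (p : ℕ) (pp : p.Prime) (h : p ∣ Ideal.absNorm v) : (p : 𝓞 F) ∈ v := by
  obtain ⟨q, n, -, hq, qp, e⟩ := Ideal.exists_prime_and_absNorm_eq_pow v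
  rw [e] at h
  rwa [(Nat.prime_dvd_prime_iff_eq pp qp).1 (pp.dvd_of_dvd_pow h)]

theorem even_count (F K : Type*) [Field F] [NumberField F] [Field K] [NumberField K] [Algebra F K]
    (p : ℕ) (pp : p.Prime) (hp : ¬ (p : ℤ) ∣ discr K) (I : Ideal (𝓞 F)) (hI : I ≠ ⊥)
    (J : Ideal (𝓞 K)) (hJ : J ^ 2 = I.map (algebraMap (𝓞 F) (𝓞 K)))
    (v : Ideal (𝓞 F)) (hv : Irreducible v) (hpv : (p : 𝓞 F) ∈ v) : ∃ n : ℕ, emultiplicity v I = 2 * n := by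
  have hvp : v.IsPrime := Ideal.isPrime_of_prime hv.prime
  have hv0 : v ≠ ⊥ := hv.ne_zero
  have hvm : v.IsMaximal := hvp.isMaximal hv0
  obtain ⟨w, hwm, hwv⟩ := Ideal.exists_maximal_ideal_liesOver_of_isIntegral (S := 𝓞 K) v
  have hwp : w.IsPrime := hwm.isPrime
  have hw0 : w ≠ ⊥ := Ideal.ne_bot_of_liesOver_of_ne_bot hv0 w
  have hpw : ((p : ℤ) : 𝓞 K) ∈ w := by
    have : algebraMap (𝓞 F) (𝓞 K) (p : 𝓞 F) ∈ w := by
      rw [hwv.over] at hpv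
      exact hpv
    simpa using this
  have hun : Algebra.IsUnramifiedAt ℤ w :=
    (not_dvd_discr_iff_forall_mem K (𝓞 K) (Nat.prime_iff_prime_int.1 pp)).1 hp w hwp hpw
  have hun2 : Algebra.IsUnramifiedAt (𝓞 F) w := Algebra.IsUnramifiedAt.of_restrictScalars ℤ w
  have h1 : w.ramificationIdx (𝓞 F) = 1 := Ideal.ramificationIdx_eq_one_of_isUnramifiedAt
  have h2 : v.ramificationIdx' w = 1 := by
    rw [Ideal.ramificationIdx'_eq_ramificationIdx v w hv0, h1]
  have hw : Irreducible w := (Ideal.prime_of_isPrime hw0 hwp).irreducible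
  have h3 := Ideal.IsDedekindDomain.emultiplicity_map_eq_ramificationIdx'_mul hI hv hw hw0
  rw [h2, Nat.cast_one, one_mul, ← hJ, emultiplicity_pow hw.prime] at h3
  have hJ0 : J ≠ ⊥ := by
    rintro rfl
    rw [← Ideal.zero_eq_bot, zero_pow two_ne_zero] at hJ
    exact Ideal.map_ne_bot_of_ne_bot hI hJ.symm
  have hfin : FiniteMultiplicity w J := FiniteMultiplicity.of_prime_left hw.prime hJ0
  refine ⟨multiplicity w J, ?_⟩
  rw [← h3, hfin.emultiplicity_eq_multiplicity]
  norm_cast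

theorem even_val (F K : Type*) [Field F] [NumberField F] [Field K] [NumberField K] [Algebra F K]
    (p : ℕ) (pp : p.Prime) (hp : ¬ (p : ℤ) ∣ discr K) (I : Ideal (𝓞 F)) (hI : I ≠ ⊥)
    (J : Ideal (𝓞 K)) (hJ : J ^ 2 = I.map (algebraMap (𝓞 F) (𝓞 K))) :
    Even ((Ideal.absNorm I).factorization p) := by
  classical
  have h1 : Ideal.absNorm I = ((normalizedFactors I).map Ideal.absNorm).prod := by
    conv_lhs => rw [← Ideal.prod_normalizedFactors_eq_self hI]
    rw [map_multiset_prod]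
  rw [h1, Finset.prod_multiset_map_count, Nat.factorization_prod]
  · rw [Finsupp.finsetSum_apply]
    refine Finset.even_sum _ fun v hv => ?_
    rw [Nat.factorization_pow, Finsupp.smul_apply, smul_eq_mul]
    by_cases h : (Ideal.absNorm v).factorization p = 0
    · rw [h]; simp
    · apply Even.mul_right
      rw [Multiset.mem_toFinset] at hv
      have hvi := irreducible_of_normalized_factor v hv
      have hvp : v.IsPrime := Ideal.isPrime_of_prime hvi.prime
      have hv0 : v ≠ ⊥ := hvi.ne_zero
      have hvm : v.IsMaximal := hvp.isMaximal hv0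
      have hpd : p ∣ Ideal.absNorm v := Nat.dvd_of_factorization_pos h
      have hpv : (p : 𝓞 F) ∈ v := by
        exact mem_of_dvd_absNorm v p pp hpd
      obtain ⟨n, hn⟩ := even_count F K p pp hp I hI J hJ v hvi hpv
      rw [emultiplicity_eq_count_normalizedFactors hvi hI, normalize_eq] at hn
      refine ⟨n, ?_⟩
      have : Multiset.count v (normalizedFactors I) = 2 * n := by exact_mod_cast hn
      omega
  · intro v hv
    rw [Multiset.mem_toFinset] at hv
    exact pow_ne_zero _ (Ideal.absNorm_eq_zero_iff.not.2 (irreducible_of_normalized_factor v hv).ne_zero)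

theorem even_val_minpoly (K : Type*) [Field K] [NumberField K] (γ : 𝓞 K) (hγ : γ ≠ 0)
    (J : Ideal (𝓞 K)) (hJ : J ^ 2 = Ideal.span {γ})
    (p : ℕ) (pp : p.Prime) (hp : ¬ (p : ℤ) ∣ discr K) :
    Even (((minpoly ℤ γ).eval 0).natAbs.factorization p) := by
  let F := IntermediateField.adjoin ℚ {(γ : K)}
  have hγint : IsIntegral ℚ (γ : K) := Algebra.IsIntegral.isIntegral _
  have hgint : IsIntegral ℤ (IntermediateField.AdjoinSimple.gen ℚ (γ : K)) := by
    rw [← isIntegral_algebraMap_iff (A := F) (B := K) (FaithfulSMul.algebraMap_injective F K)]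
    exact RingOfIntegers.isIntegral_coe γ
  let g : 𝓞 F := ⟨IntermediateField.AdjoinSimple.gen ℚ (γ : K), hgint⟩
  have hg : algebraMap (𝓞 F) (𝓞 K) g = γ := by
    apply RingOfIntegers.ext
    rfl
  have hm : minpoly ℤ g = minpoly ℤ γ := by
    rw [← hg]
    exact (minpoly.algebraMap_eq (FaithfulSMul.algebraMap_injective (𝓞 F) (𝓞 K)) g).symm
  have hmin : minpoly ℚ (γ : K) = (minpoly ℤ γ).map (algebraMap ℤ ℚ) :=
    minpoly.isIntegrallyClosed_eq_field_fractions ℚ K (RingOfIntegers.isIntegral γ)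
  have hfr : Module.finrank ℚ F = (minpoly ℤ γ).natDegree := by
    rw [IntermediateField.adjoin.finrank hγint, hmin, (minpoly.monic (RingOfIntegers.isIntegral γ)).natDegree_map]
  have h1 := abs_norm_sub_int F g 0
  rw [hm, hfr, Nat.div_self (by rw [← hfr]; exact Module.finrank_pos), pow_one, Int.cast_zero, sub_zero] at h1
  rw [← h1, ← Ideal.absNorm_span_singleton]
  refine even_val F K p pp hp (Ideal.span {g}) ?_ J ?_
  · rw [Ne, Ideal.span_singleton_eq_bot]
    rintro h
    rw [h, map_zero] at hg
    exact hγ hg.symm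
  · rw [hJ, Ideal.map_span, Set.image_singleton, hg]

end

section

open NumberField UniqueFactorizationMonoid

theorem divisor_bound (ε : ℝ) (hε : 0 < ε) : ∃ C : ℝ, 0 < C ∧ ∀ m : ℕ, m ≠ 0 →
    (m.divisors.card : ℝ) ≤ C * (m : ℝ) ^ ε := by
  have hl2 : 0 < Real.log 2 := Real.log_pos (by norm_num)
  set c : ℝ := min 1 (ε * Real.log 2) with hc
  have hc0 : 0 < c := lt_min one_pos (by positivity)
  have hc1 : c ≤ 1 := min_le_left _ _
  have hM : 1 ≤ 1 / c := by rw [le_div_iff₀ hc0]; linarith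
  obtain ⟨B, hB⟩ := exists_nat_gt ((2 : ℝ) ^ (1 / ε))
  refine ⟨(1 / c) ^ B, by positivity, fun m hm => ?_⟩
  have h1 : (m : ℝ) ^ ε = ∏ q ∈ m.primeFactors, ((q : ℝ) ^ (m.factorization q)) ^ ε := by
    conv_lhs => rw [← Nat.prod_factorization_pow_eq_self hm]
    rw [Finsupp.prod, Nat.support_factorization]
    push_cast
    rw [Real.finsetProd_rpow]
    intro i _; positivity
  rw [Nat.card_divisors hm, h1]
  push_cast
  have h2 : ∏ q ∈ m.primeFactors, (if q < B then 1 / c else 1) ≤ (1 / c) ^ B := by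
    rw [Finset.prod_ite, Finset.prod_const, Finset.prod_const_one, mul_one]
    refine pow_le_pow_right₀ hM ?_
    calc _ ≤ (Finset.range B).card := Finset.card_le_card fun q hq => by
          rw [Finset.mem_range]; exact (Finset.mem_filter.1 hq).2
      _ = B := Finset.card_range B
  refine le_trans ?_ (mul_le_mul_of_nonneg_right h2 (Finset.prod_nonneg fun _ _ => by positivity))
  rw [← Finset.prod_mul_distrib]
  refine Finset.prod_le_prod (fun _ _ => by positivity) fun q hq => ?_
  have hq2 : 2 ≤ q := (Nat.prime_of_mem_primeFactors hq).two_le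
  have hq2' : (2 : ℝ) ≤ q := by exact_mod_cast hq2
  set v := m.factorization q
  split_ifs with hqB
  · rw [div_mul_eq_mul_div, le_div_iff₀ hc0, one_mul]
    have : (2 : ℝ) ^ (ε * v) ≤ ((q : ℝ) ^ v) ^ ε := by
      rw [← Real.rpow_natCast, ← Real.rpow_mul (by positivity), mul_comm (v : ℝ)]
      gcongr
    refine le_trans ?_ this
    rw [Real.rpow_def_of_pos (by norm_num)]
    have := Real.add_one_le_exp (Real.log 2 * (ε * v))
    refine le_trans ?_ this
    have e1 : c * v ≤ (ε * Real.log 2) * v := by gcongr; exact min_le_right _ _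
    nlinarith
  · push Not at hqB
    rw [one_mul]
    have hq3 : (2 : ℝ) ≤ (q : ℝ) ^ ε := by
      have : (2 : ℝ) ^ (1 / ε) ≤ q := hB.le.trans (by exact_mod_cast hqB)
      calc (2 : ℝ) = ((2 : ℝ) ^ (1 / ε)) ^ ε := by
            rw [← Real.rpow_mul (by norm_num), one_div_mul_cancel hε.ne', Real.rpow_one]
        _ ≤ _ := by gcongr
    have : ((q : ℝ) ^ v) ^ ε = ((q : ℝ) ^ ε) ^ v := by
      rw [← Real.rpow_natCast, ← Real.rpow_mul (by positivity), mul_comm, Real.rpow_mul (by positivity), Real.rpow_natCast]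
    rw [this]
    calc (v : ℝ) + 1 ≤ 2 ^ v := by exact_mod_cast Nat.lt_two_pow_self
      _ ≤ _ := by gcongr

theorem enum_primes (K : Type*) [Field K] [NumberField K] (q : ℕ) (hq : q.Prime) :
    ∃ P : Fin (Module.finrank ℚ K) → Ideal (𝓞 K), ∀ v : Ideal (𝓞 K), Irreducible v → (q : 𝓞 K) ∈ v → v ∈ Set.range P := by
  classical
  have hqp : Prime (q : ℤ) := Nat.prime_iff_prime_int.1 hq
  have : (Ideal.span {(q : ℤ)}).IsMaximal :=
    PrincipalIdealRing.isMaximal_of_irreducible hqp.irreducible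
  have h0 : Ideal.span {(q : ℤ)} ≠ ⊥ := by
    rw [Ne, Ideal.span_singleton_eq_bot]; exact hqp.ne_zero
  have hc := Ideal.card_primesOverFinset_le_finrank (𝓞 K) ℚ K h0
  set s := IsDedekindDomain.primesOverFinset (Ideal.span {(q : ℤ)}) (𝓞 K) with hs
  refine ⟨fun i => if h : i.1 < s.card then (s.equivFin.symm ⟨i.1, h⟩ : Ideal (𝓞 K)) else ⊥, ?_⟩
  intro v hv hqv
  have hvp : v.IsPrime := Ideal.isPrime_of_prime hv.prime
  have hvs : v ∈ s := by
    rw [hs, IsDedekindDomain.mem_primesOverFinset_iff h0]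
    refine ⟨hvp, (Ideal.liesOver_span_iff hvp.ne_top hqp).2 (by simpa using hqv)⟩
  refine ⟨⟨(s.equivFin ⟨v, hvs⟩).1, (s.equivFin ⟨v, hvs⟩).2.trans_le hc⟩, ?_⟩
  simp

theorem card_ideals_norm (K : Type*) [Field K] [NumberField K] (m : ℕ) (hm : m ≠ 0)
    (S : Finset (Ideal (𝓞 K))) (hS : ∀ J ∈ S, Ideal.absNorm J = m) :
    S.card ≤ m.divisors.card ^ (Module.finrank ℚ K) := by
  classical
  have hP : ∀ q : ℕ, ∃ P : Fin (Module.finrank ℚ K) → Ideal (𝓞 K), q.Prime → ∀ v : Ideal (𝓞 K), Irreducible v → (q : 𝓞 K) ∈ v → v ∈ Set.range P := by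
    intro q
    by_cases hq : q.Prime
    · obtain ⟨P, hP⟩ := enum_primes K q hq
      exact ⟨P, fun _ => hP⟩
    · exact ⟨fun _ => ⊥, fun h => absurd h hq⟩
  choose P hP using hP
  let f : Ideal (𝓞 K) → (q : ℕ) → q ∈ m.primeFactors → Fin (Module.finrank ℚ K) → ℕ :=
    fun J q _ i => if (q : 𝓞 K) ∈ P q i ∧ Irreducible (P q i) then (normalizedFactors J).count (P q i) else 0
  have hJ0 : ∀ J ∈ S, J ≠ ⊥ := by
    rintro J hJ rfl
    have := hS _ hJ
    rw [Ideal.absNorm_bot] at this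
    exact hm this.symm
  have hcard : (m.primeFactors.pi (fun q => Fintype.piFinset (fun _ : Fin (Module.finrank ℚ K) => Finset.range (m.factorization q + 1)))).card
      = m.divisors.card ^ (Module.finrank ℚ K) := by
    rw [Finset.card_pi, Nat.card_divisors hm, ← Finset.prod_pow]
    refine Finset.prod_congr rfl fun q _ => ?_
    rw [Fintype.card_piFinset_const, Finset.card_range]
  rw [← hcard]
  refine Finset.card_le_card_of_injOn f ?_ ?_
  · intro J hJ
    rw [Finset.mem_coe, Finset.mem_pi]
    intro q hq
    rw [Fintype.mem_piFinset]
    intro i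
    rw [Finset.mem_range, Nat.lt_succ_iff]
    simp only [f]
    split_ifs with h
    · obtain ⟨h1, h2⟩ := h
      have hqp := Nat.prime_of_mem_primeFactors hq
      rw [← hqp.pow_dvd_iff_le_factorization hm]
      have hd : P q i ^ (normalizedFactors J).count (P q i) ∣ J := by
        have := emultiplicity_eq_count_normalizedFactors h2 (hJ0 J hJ)
        rw [normalize_eq] at this
        exact pow_dvd_of_le_emultiplicity this.ge
      have hd2 := map_dvd Ideal.absNorm hd
      rw [map_pow, hS J hJ] at hd2
      refine (pow_dvd_pow_of_dvd ?_ _).trans hd2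
      have hvp : (P q i).IsPrime := Ideal.isPrime_of_prime h2.prime
      have hvm : (P q i).IsMaximal := hvp.isMaximal h2.ne_zero
      obtain ⟨r, n, hn, hr, rp, e⟩ := Ideal.exists_prime_and_absNorm_eq_pow (P q i)
      have hrq : r = q := by
        by_contra hne
        have hco : IsCoprime (r : ℤ) (q : ℤ) := Nat.isCoprime_iff_coprime.2 ((Nat.coprime_primes rp hqp).2 hne)
        obtain ⟨a, b, hab⟩ := hco
        apply hvp.ne_top
        rw [Ideal.eq_top_iff_one]
        have : ((a * r + b * q : ℤ) : 𝓞 K) ∈ P q i := by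
          push_cast
          exact add_mem (Ideal.mul_mem_left _ _ hr) (Ideal.mul_mem_left _ _ h1)
        rwa [hab, Int.cast_one] at this
      rw [e, hrq]
      exact dvd_pow_self _ hn.ne'
    · exact Nat.zero_le _
  · intro I hI J hJ hIJ
    have hI' := hJ0 I hI
    have hJ' := hJ0 J hJ
    rw [← Ideal.prod_normalizedFactors_eq_self hI', ← Ideal.prod_normalizedFactors_eq_self hJ']
    congr 1
    ext v
    by_cases hv : Irreducible v
    swap
    · rw [Multiset.count_eq_zero_of_notMem fun h => hv (irreducible_of_normalized_factor v h),
        Multiset.count_eq_zero_of_notMem fun h => hv (irreducible_of_normalized_factor v h)]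
    have hvp : v.IsPrime := Ideal.isPrime_of_prime hv.prime
    have hvm : v.IsMaximal := hvp.isMaximal hv.ne_zero
    obtain ⟨r, n, hn, hr, rp, e⟩ := Ideal.exists_prime_and_absNorm_eq_pow v
    by_cases hrm : r ∈ m.primeFactors
    · obtain ⟨i, hi⟩ := hP r rp v hv hr
      have := congrFun (congrFun (congrFun hIJ r) hrm) i
      simp only [f, hi] at this
      rwa [if_pos ⟨hr, hv⟩, if_pos ⟨hr, hv⟩] at this
    · have hnot : ∀ I ∈ S, v ∉ normalizedFactors I := by
        intro I hI h
        apply hrm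
        rw [Nat.mem_primeFactors]
        refine ⟨rp, ?_, hm⟩
        have := map_dvd Ideal.absNorm (dvd_of_mem_normalizedFactors h)
        rw [hS I hI, e] at this
        exact (dvd_pow_self r hn.ne').trans this
      rw [Multiset.count_eq_zero_of_notMem (hnot I hI), Multiset.count_eq_zero_of_notMem (hnot J hJ)]

end

section

open NumberField NumberField.InfinitePlace

theorem abs_norm_le_pow (K : Type*) [Field K] [NumberField K] (γ : 𝓞 K) (X : ℝ)
    (hγ : ∀ w : InfinitePlace K, w (γ : K) ≤ X) :
    ((Algebra.norm ℤ γ).natAbs : ℝ) ≤ X ^ (Module.finrank ℚ K) := by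
  have h2 : ((Algebra.norm ℤ γ).natAbs : ℝ) = ∏ w : InfinitePlace K, w (γ : K) ^ mult w := by
    rw [prod_eq_abs_norm, ← Algebra.coe_norm_int, Nat.cast_natAbs]
    push_cast; rfl
  rw [h2]
  calc _ ≤ ∏ w : InfinitePlace K, X ^ mult w := by
        refine Finset.prod_le_prod (fun w _ => by positivity) fun w _ => ?_
        gcongr
        exact hγ w
    _ = _ := by rw [Finset.prod_pow_eq_pow_sum, sum_mult_eq]

theorem squarefree_dvd_of_odd {n D : ℕ} (hn : n ≠ 0) (hD : D ≠ 0)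
    (h : ∀ p : ℕ, p.Prime → ¬ p ∣ D → Even (n.factorization p)) :
    ∃ a b : ℕ, n = b ^ 2 * a ∧ a ∣ D := by
  obtain ⟨a, b, hab, hsq⟩ := Nat.sq_mul_squarefree n
  refine ⟨a, b, hab.symm, ?_⟩
  have ha : a ≠ 0 := hsq.ne_zero
  have hb : b ^ 2 ≠ 0 := by rintro h0; rw [h0, zero_mul] at hab; exact hn hab.symm
  rw [← Nat.factorization_prime_le_iff_dvd ha hD]
  intro p pp
  have h1 : a.factorization p ≤ 1 := hsq.natFactorization_le_one p
  by_cases hp : p ∣ D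
  · exact h1.trans ((pp.dvd_iff_one_le_factorization hD).1 hp)
  · have h2 := h p pp hp
    rw [← hab, Nat.factorization_mul hb ha, Nat.factorization_pow] at h2
    simp only [Finsupp.add_apply, Finsupp.smul_apply, smul_eq_mul] at h2
    have h3 : a.factorization p = 0 := by
      rcases h2 with ⟨r, hr⟩; omega
    rw [h3]; exact Nat.zero_le _

theorem even_part (d : ℕ) (hd : 3 < d) : ∃ C : ℝ, 0 < C ∧
    ∀ (K : Type) [Field K] [NumberField K], Module.finrank ℚ K = d → ∀ (S : Finset (Ideal (𝓞 K))),
      (∀ J ∈ S, ∃ γ : 𝓞 K, γ ≠ 0 ∧ J ^ 2 = Ideal.span {γ} ∧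
        (∀ w : InfinitePlace K, w (γ : K) ≤ 9 * |(discr K : ℝ)| ^ (1 / (d : ℝ))) ∧
        Even (d / (minpoly ℤ γ).natDegree)) →
      (S.card : ℝ) ≤ C * |(discr K : ℝ)| ^ ((1 : ℝ) / 2 - 1 / (2 * (d : ℝ))) := by
  have hd4 : (4 : ℝ) ≤ d := by exact_mod_cast hd
  have hd0 : (0 : ℝ) < d := by linarith
  set ε : ℝ := 1 / (16 * d) with hε
  have hε0 : 0 < ε := by positivity
  obtain ⟨C1, hC1, hdiv⟩ := divisor_bound ε hε0
  refine ⟨(C1 * ((3 : ℝ) ^ d) ^ ε) ^ d * ((d + 1) * (2 * 3 ^ d) * C1), by positivity, ?_⟩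
  intro K _ _ hK S hS
  classical
  set D : ℝ := |(discr K : ℝ)| with hD
  have hD1 : 1 ≤ D := one_le_abs_discr K
  have hD0 : 0 < D := by linarith
  have hDnat : ((discr K).natAbs : ℝ) = D := by rw [Nat.cast_natAbs, hD]; push_cast; rfl
  have hDn0 : (discr K).natAbs ≠ 0 := Int.natAbs_ne_zero.2 (discr_ne_zero K)
  set B : ℝ := 3 ^ d * D ^ (1 / 4 : ℝ) with hB
  have hB1 : 1 ≤ B := by
    have : 1 ≤ D ^ (1 / 4 : ℝ) := Real.one_le_rpow hD1 (by norm_num)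
    have h3 : (1 : ℝ) ≤ 3 ^ d := one_le_pow₀ (by norm_num)
    nlinarith
  -- structure of norms
  have key : ∀ J ∈ S, Ideal.absNorm J ≠ 0 ∧ (Ideal.absNorm J : ℝ) ≤ 3 ^ d * D ^ (1 / 2 : ℝ) ∧
      ∃ k ∈ Finset.range (d + 1), ∃ b ∈ Finset.range (⌊B⌋₊ + 1), ∃ a ∈ (discr K).natAbs.divisors,
        Ideal.absNorm J = (b ^ 2 * a) ^ k := by
    intro J hJ
    obtain ⟨γ, hγ0, hJγ, hbox, ⟨j, hj⟩⟩ := hS J hJ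
    have h1 := congrArg Ideal.absNorm hJγ
    rw [map_pow, Ideal.absNorm_span_singleton] at h1
    have h2 := abs_norm_le_pow K γ _ hbox
    have h3 := abs_norm_sub_int K γ 0
    rw [Int.cast_zero, sub_zero, ← h1, hK, hj] at h3
    set n := ((minpoly ℤ γ).eval 0).natAbs with hn
    have hm : Ideal.absNorm J = n ^ j := by
      apply Nat.pow_left_injective two_ne_zero
      simp only
      rw [h3]; ring
    have hJ0 : Ideal.absNorm J ≠ 0 := by
      intro h
      rw [h, zero_pow two_ne_zero] at h1
      have : Algebra.norm ℤ γ = 0 := Int.natAbs_eq_zero.1 h1.symm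
      exact hγ0 (Algebra.norm_eq_zero_iff.1 this)
    have hm2 : (Ideal.absNorm J : ℝ) ≤ 3 ^ d * D ^ (1 / 2 : ℝ) := by
      rw [← h1, hK] at h2
      push_cast at h2
      refine le_of_sq_le_sq ?_ (by positivity)
      refine h2.trans (le_of_eq ?_)
      rw [mul_pow, mul_pow, ← Real.rpow_natCast (D ^ (1 / (d : ℝ))), ← Real.rpow_mul hD0.le, ← Real.rpow_natCast (D ^ (1 / 2 : ℝ)), ← Real.rpow_mul hD0.le,
        one_div_mul_cancel hd0.ne']
      norm_num
      rw [← pow_mul, mul_comm d 2, pow_mul]; norm_num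
    have hmindeg : 0 < (minpoly ℤ γ).natDegree := minpoly.natDegree_pos (RingOfIntegers.isIntegral γ)
    have hjpos : j ≠ 0 := by
      rintro rfl
      have hle : (minpoly ℤ γ).natDegree ≤ d := by
        have hmin : minpoly ℚ (γ : K) = (minpoly ℤ γ).map (algebraMap ℤ ℚ) :=
          minpoly.isIntegrallyClosed_eq_field_fractions ℚ K (RingOfIntegers.isIntegral γ)
        have := minpoly.natDegree_le (A := ℚ) (γ : K)
        rwa [hmin, (minpoly.monic (RingOfIntegers.isIntegral γ)).natDegree_map, hK] at this
      have := Nat.div_pos hle hmindeg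
      omega
    have hn0 : n ≠ 0 := by
      intro h; rw [h, zero_pow hjpos] at hm; exact hJ0 hm
    have hjd : j ≤ d := by
      have := Nat.div_le_self d (minpoly ℤ γ).natDegree
      omega
    obtain ⟨a, b, hab, had⟩ := squarefree_dvd_of_odd hn0 hDn0 fun p pp hp =>
      even_val_minpoly K γ hγ0 J hJγ p pp (by rwa [Int.natCast_dvd])
    refine ⟨hJ0, hm2, j, Finset.mem_range.2 (by omega), b, ?_, a, Nat.mem_divisors.2 ⟨had, hDn0⟩, by rw [hm, hab]⟩
    rw [Finset.mem_range, Nat.lt_succ_iff]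
    apply Nat.le_floor
    have ha0 : 0 < a := Nat.pos_of_dvd_of_pos had (Nat.pos_of_ne_zero hDn0)
    have hb2 : b ^ 2 ≤ Ideal.absNorm J := by
      calc b ^ 2 ≤ b ^ 2 * a := Nat.le_mul_of_pos_right _ ha0
        _ = n := hab.symm
        _ ≤ n ^ j := Nat.le_self_pow hjpos n
        _ = _ := hm.symm
    have hb2' : (b : ℝ) ^ 2 ≤ Ideal.absNorm J := by exact_mod_cast hb2
    refine le_of_sq_le_sq ?_ (by linarith)
    refine (hb2'.trans hm2).trans ?_
    rw [hB, mul_pow, ← Real.rpow_natCast (D ^ (1 / 4 : ℝ)), ← Real.rpow_mul hD0.le]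
    norm_num
    have h3 : (1 : ℝ) ≤ 3 ^ d := one_le_pow₀ (by norm_num)
    have : (3 : ℝ) ^ d ≤ (3 ^ d) ^ 2 := by nlinarith
    gcongr
  -- number of norms
  let M : Finset ℕ := S.image Ideal.absNorm
  have hMcard : M.card ≤ (d + 1) * (⌊B⌋₊ + 1) * (discr K).natAbs.divisors.card := by
    have hsub : M ⊆ (Finset.range (d + 1) ×ˢ Finset.range (⌊B⌋₊ + 1) ×ˢ (discr K).natAbs.divisors).image
        (fun x => (x.2.1 ^ 2 * x.2.2) ^ x.1) := by
      intro m hm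
      obtain ⟨J, hJ, rfl⟩ := Finset.mem_image.1 hm
      obtain ⟨-, -, k, hk, b, hb, a, ha, e⟩ := key J hJ
      rw [Finset.mem_image]
      exact ⟨(k, b, a), Finset.mem_product.2 ⟨hk, Finset.mem_product.2 ⟨hb, ha⟩⟩, e.symm⟩
    refine (Finset.card_le_card hsub).trans (Finset.card_image_le.trans ?_)
    rw [Finset.card_product, Finset.card_product, Finset.card_range, Finset.card_range, mul_assoc]
  have hfib : ∀ m ∈ M, (S.filter fun J => Ideal.absNorm J = m).card ≤ ⌊(C1 * (3 ^ d * D ^ (1 / 2 : ℝ)) ^ ε) ^ d⌋₊ := by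
    intro m hm
    obtain ⟨J, hJ, rfl⟩ := Finset.mem_image.1 hm
    obtain ⟨h0, hle, -⟩ := key J hJ
    apply Nat.le_floor
    have h1 := card_ideals_norm K _ h0 (S.filter fun J' => Ideal.absNorm J' = Ideal.absNorm J) fun J' hJ' => (Finset.mem_filter.1 hJ').2
    rw [hK] at h1
    calc ((S.filter fun J' => Ideal.absNorm J' = Ideal.absNorm J).card : ℝ) ≤ ((Ideal.absNorm J).divisors.card : ℝ) ^ d := by exact_mod_cast h1
      _ ≤ (C1 * (Ideal.absNorm J : ℝ) ^ ε) ^ d := by gcongr; exact hdiv _ h0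
      _ ≤ _ := by gcongr
  have hS1 := Finset.card_le_mul_card_image (f := Ideal.absNorm) S _ hfib
  have hS2 : (S.card : ℝ) ≤ (C1 * (3 ^ d * D ^ (1 / 2 : ℝ)) ^ ε) ^ d * ((d + 1) * (2 * B) * (C1 * D ^ ε)) := by
    have e1 : (S.card : ℝ) ≤ (⌊(C1 * (3 ^ d * D ^ (1 / 2 : ℝ)) ^ ε) ^ d⌋₊ : ℝ) * M.card := by exact_mod_cast hS1
    have e2 : (M.card : ℝ) ≤ (d + 1) * (⌊B⌋₊ + 1) * (discr K).natAbs.divisors.card := by exact_mod_cast hMcard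
    refine e1.trans ?_
    have e3 := Nat.floor_le (a := (C1 * (3 ^ d * D ^ (1 / 2 : ℝ)) ^ ε) ^ d) (by positivity)
    have e4 := Nat.floor_le (a := B) (by linarith)
    have e5 := hdiv _ hDn0
    rw [hDnat] at e5
    have e6 : (⌊B⌋₊ : ℝ) + 1 ≤ 2 * B := by linarith
    refine mul_le_mul e3 (e2.trans ?_) (by positivity) (by positivity)
    gcongr
  refine hS2.trans ?_
  have hpow : (D ^ (1 / 2 * ε)) ^ d * (D ^ (1 / 4 : ℝ) * D ^ ε) ≤ D ^ ((1 : ℝ) / 2 - 1 / (2 * (d : ℝ))) := by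
    rw [← Real.rpow_natCast, ← Real.rpow_mul hD0.le, ← Real.rpow_add hD0, ← Real.rpow_add hD0]
    apply Real.rpow_le_rpow_of_exponent_le hD1
    have f1 : 1 / 2 * ε * d = 1 / 32 := by rw [hε]; field_simp; norm_num
    have f2 : (1 : ℝ) / d ≤ 1 / 4 := one_div_le_one_div_of_le (by norm_num) hd4
    have f3 : ε = (1 / d) / 16 := by rw [hε]; field_simp
    have f4 : 1 / (2 * (d : ℝ)) = (1 / d) / 2 := by field_simp
    rw [f1, f4, f3]
    linarith
  calc (C1 * (3 ^ d * D ^ (1 / 2 : ℝ)) ^ ε) ^ d * ((d + 1) * (2 * B) * (C1 * D ^ ε))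
      = (C1 * ((3 : ℝ) ^ d) ^ ε) ^ d * ((d + 1) * (2 * 3 ^ d) * C1) * ((D ^ (1 / 2 * ε)) ^ d * (D ^ (1 / 4 : ℝ) * D ^ ε)) := by
        rw [hB, Real.mul_rpow (by positivity) (by positivity), ← Real.rpow_mul hD0.le, mul_pow, mul_pow, mul_pow]
        ring
    _ ≤ _ := by gcongr

end

section

open NumberField NumberField.InfinitePlace UniqueFactorizationMonoid nonZeroDivisors

theorem ideal_sq_inj {K : Type*} [Field K] [NumberField K] {I J : Ideal (𝓞 K)} (hI : I ≠ ⊥) (hJ : J ≠ ⊥)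
    (h : I ^ 2 = J ^ 2) : I = J := by
  classical
  have h1 := congrArg normalizedFactors h
  rw [normalizedFactors_pow, normalizedFactors_pow] at h1
  rw [← Ideal.prod_normalizedFactors_eq_self hI, ← Ideal.prod_normalizedFactors_eq_self hJ]
  congr 1
  ext v
  have := congrArg (Multiset.count v) h1
  rw [Multiset.count_nsmul, Multiset.count_nsmul] at this
  omega

theorem final_count (d : ℕ) (hd : 2 < d) : ∃ C : ℝ, 0 < C ∧
    ∀ (K : Type) [Field K] [NumberField K], Module.finrank ℚ K = d → ∀ L : ℝ,
      1 ≤ L → (Odd d ∨ Real.log |(discr K : ℝ)| ≤ L) →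
      (Nat.card {c : ClassGroup (𝓞 K) // c ^ 2 = 1} : ℝ) ≤ C * |(discr K : ℝ)| ^ ((1 : ℝ) / 2 - 1 / (2 * (d : ℝ))) * L := by
  obtain ⟨C1, hC1, h1⟩ := odd_part d (by omega)
  obtain ⟨C2, hC2, h2⟩ : ∃ C : ℝ, 0 < C ∧
    ∀ (K : Type) [Field K] [NumberField K], Module.finrank ℚ K = d → ∀ (S : Finset (Ideal (𝓞 K))),
      (∀ J ∈ S, ∃ γ : 𝓞 K, γ ≠ 0 ∧ J ^ 2 = Ideal.span {γ} ∧
        (∀ w : InfinitePlace K, w (γ : K) ≤ 9 * |(discr K : ℝ)| ^ (1 / (d : ℝ))) ∧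
        Even (d / (minpoly ℤ γ).natDegree)) →
      (S.card : ℝ) ≤ C * |(discr K : ℝ)| ^ ((1 : ℝ) / 2 - 1 / (2 * (d : ℝ))) := by
    by_cases hd3 : d = 3
    · refine ⟨1, one_pos, ?_⟩
      intro K _ _ hK S hS
      have : S = ∅ := by
        rw [Finset.eq_empty_iff_forall_notMem]
        intro J hJ
        obtain ⟨γ, -, -, -, hev⟩ := hS J hJ
        have hdvd : (minpoly ℤ γ).natDegree ∣ d := by
          have hmin : minpoly ℚ (γ : K) = (minpoly ℤ γ).map (algebraMap ℤ ℚ) :=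
            minpoly.isIntegrallyClosed_eq_field_fractions ℚ K (RingOfIntegers.isIntegral γ)
          have := minpoly.degree_dvd (K := ℚ) (Algebra.IsIntegral.isIntegral (γ : K))
          rwa [hmin, (minpoly.monic (RingOfIntegers.isIntegral γ)).natDegree_map, hK] at this
        have : Odd (d / (minpoly ℤ γ).natDegree) :=
          Odd.of_dvd_nat (by rw [hd3]; decide) (Nat.div_dvd_of_dvd hdvd)
        exact (Nat.not_odd_iff_even.2 hev) this
      rw [this, Finset.card_empty, Nat.cast_zero]
      positivity
    · exact even_part d (by omega)
  refine ⟨C1 + C2, by positivity, ?_⟩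
  intro K _ _ hK L hL hA
  classical
  have hD1 : 1 ≤ |(discr K : ℝ)| := one_le_abs_discr K
  choose J γ hγ0 hJc hJγ hbox using fun c : {c : ClassGroup (𝓞 K) // c ^ 2 = 1} => class_rep K c.1 c.2
  rw [hK] at hbox
  have hJ0 : ∀ c, (J c : Ideal (𝓞 K)) ≠ ⊥ := fun c => nonZeroDivisors.ne_zero (J c).2
  have hJinj : Function.Injective (fun c => (J c : Ideal (𝓞 K))) := by
    intro c c' h
    have : J c = J c' := Subtype.ext h
    exact Subtype.ext (by rw [← hJc, ← hJc, this])
  have hγinj : Function.Injective γ := by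
    intro c c' h
    apply hJinj
    apply ideal_sq_inj (hJ0 c) (hJ0 c')
    rw [hJγ, hJγ, h]
  letI : Fintype {c : ClassGroup (𝓞 K) // c ^ 2 = 1} := Fintype.ofFinite _
  set U : Finset {c : ClassGroup (𝓞 K) // c ^ 2 = 1} := Finset.univ.filter fun c => Odd (d / (minpoly ℤ (γ c)).natDegree)
  set V : Finset {c : ClassGroup (𝓞 K) // c ^ 2 = 1} := Finset.univ.filter fun c => ¬ Odd (d / (minpoly ℤ (γ c)).natDegree)
  have hsum : Nat.card {c : ClassGroup (𝓞 K) // c ^ 2 = 1} = U.card + V.card := by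
    rw [Nat.card_eq_fintype_card, ← Finset.card_univ]
    exact (Finset.card_filter_add_card_filter_not _).symm
  have bU := h1 K hK (U.image γ) L hL hA ?_ ?_ ?_
  rotate_left
  · intro x hx w
    obtain ⟨c, hc, rfl⟩ := Finset.mem_image.1 hx
    exact hbox c w
  · intro x hx
    obtain ⟨c, hc, rfl⟩ := Finset.mem_image.1 hx
    exact ⟨_, hJγ c⟩
  · intro x hx
    obtain ⟨c, hc, rfl⟩ := Finset.mem_image.1 hx
    exact (Finset.mem_filter.1 hc).2
  have bV := h2 K hK (V.image fun c => (J c : Ideal (𝓞 K))) ?_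
  rotate_left
  · intro x hx
    obtain ⟨c, hc, rfl⟩ := Finset.mem_image.1 hx
    exact ⟨γ c, hγ0 c, hJγ c, hbox c, Nat.not_odd_iff_even.1 (Finset.mem_filter.1 hc).2⟩
  rw [Finset.card_image_of_injective _ hγinj] at bU
  rw [Finset.card_image_of_injective _ hJinj] at bV
  rw [hsum]
  push_cast
  have hpos : 0 ≤ C2 * |(discr K : ℝ)| ^ ((1 : ℝ) / 2 - 1 / (2 * (d : ℝ))) := by positivity
  nlinarith

end

theorem two_torsion_class_group_bound (d : ℕ) (hd : 2 < d) :
    ∃ C : ℝ, 0 < C ∧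
      ∀ (K : Type) [Field K] [NumberField K],
        Module.finrank ℚ K = d →
        (Nat.card {c : ClassGroup (NumberField.RingOfIntegers K) // c ^ 2 = 1} : ℝ) ≤
          if Odd d then
            C * |(NumberField.discr K : ℝ)| ^ ((1 : ℝ) / 2 - 1 / (2 * (d : ℝ)))
          else
            C * |(NumberField.discr K : ℝ)| ^ ((1 : ℝ) / 2 - 1 / (2 * (d : ℝ))) *
              Real.log |(NumberField.discr K : ℝ)| := by
  obtain ⟨C, hC, h⟩ := final_count d hd
  refine ⟨C, hC, ?_⟩
  intro K _ _ hK
  split_ifs with hodd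
  · have := h K hK 1 le_rfl (Or.inl hodd)
    rwa [mul_one] at this
  · refine h K hK _ ?_ (Or.inr le_rfl)
    have h2 : 2 < |NumberField.discr K| := NumberField.abs_discr_gt_two (by omega)
    have h3 : (3 : ℝ) ≤ |(NumberField.discr K : ℝ)| := by
      have : (3 : ℤ) ≤ |NumberField.discr K| := by omega
      exact_mod_cast this
    rw [Real.le_log_iff_exp_le (by linarith)]
    linarith [Real.exp_one_lt_d9]
end

section
/- For each integer d ≥ 1 there exist a homogeneous polynomial f ∈ ℤ[x_0,x_1,x_2] of degree d that is irreducible over the algebraic closure of ℚ, and an integer B ≥ 1, such that (1/5)·d^2·B^{2/d} ≤ N(f,B). -/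
/-- The number of rational points of `ℙ^{N-1}(ℚ)` of height at most `B` lying on the
projective hypersurface cut out by the homogeneous polynomial `f ∈ ℤ[x_0,…,x_{N-1}]`.
A point is counted via a primitive integer coordinate vector, all of whose entries
have absolute value at most `B`. -/
noncomputable def Nproj {N : ℕ} (f : MvPolynomial (Fin N) ℤ) (B : ℝ) : ℕ :=
  Set.ncard {P : Projectivization ℚ (Fin N → ℚ) |
    ∃ (v : Fin N → ℤ) (hv : (fun i => (v i : ℚ)) ≠ 0),
      Finset.univ.gcd v = 1 ∧
      MvPolynomial.eval v f = 0 ∧ (∀ i, |(v i : ℝ)| ≤ B) ∧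
      P = Projectivization.mk ℚ (fun i => (v i : ℚ)) hv}

open MvPolynomial in
/-- The curve `∏_{i<d} (x - i z) = z ∏_{j<d-1} (y - j z)`. -/
noncomputable def crv (R : Type*) [CommRing R] (d : ℕ) : MvPolynomial (Fin 3) R :=
  ∏ i ∈ Finset.range d, (X 0 - C (i : R) * X 2)
    - X 2 * ∏ j ∈ Finset.range (d - 1), (X 1 - C (j : R) * X 2)

open MvPolynomial in
theorem crv_hom (R : Type*) [CommRing R] (d : ℕ) (hd : 1 ≤ d) : (crv R d).IsHomogeneous d := by
  have h (k : Fin 3) (i : ℕ) : (X k - C (i : R) * X 2 : MvPolynomial (Fin 3) R).IsHomogeneous 1 := by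
    refine (isHomogeneous_X R k).sub ?_
    simpa using (isHomogeneous_C (Fin 3) (i : R)).mul (isHomogeneous_X R 2)
  unfold crv
  refine IsHomogeneous.sub ?_ ?_
  · simpa using IsHomogeneous.prod (Finset.range d) _ (fun _ => 1) (fun i _ => h 0 i)
  · have := (isHomogeneous_X R (2 : Fin 3)).mul
      (IsHomogeneous.prod (Finset.range (d-1)) _ (fun _ => 1) (fun i _ => h 1 i))
    have e : 1 + ∑ i ∈ Finset.range (d-1), 1 = d := by simp; omega
    rwa [e] at this

open MvPolynomial in
theorem crv_map (K : Type*) [Field K] (d : ℕ) :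
    MvPolynomial.map (Int.castRingHom K) (crv ℤ d) = crv K d := by
  simp [crv, map_prod]

open MvPolynomial in
theorem crv_irred (K : Type*) [Field K] (d : ℕ) (hd : 1 ≤ d) : Irreducible (crv K d) := by
  rw [← MulEquiv.irreducible_iff (finSuccEquiv K 2)]
  set z : MvPolynomial (Fin 2) K := X 1 with hz
  set b : MvPolynomial (Fin 2) K := ∏ j ∈ Finset.range (d - 1), (X 0 - C (j : K) * z) with hb
  have e2 : (finSuccEquiv K 2) (X 2) = Polynomial.C z := finSuccEquiv_X_succ (j := (1 : Fin 2))
  have e1 : (finSuccEquiv K 2) (X 1) = Polynomial.C (X 0) := finSuccEquiv_X_succ (j := (0 : Fin 2))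
  have e0 : (finSuccEquiv K 2) (X 0) = Polynomial.X := finSuccEquiv_X_zero
  have key : finSuccEquiv K 2 (crv K d) =
      ∏ i ∈ Finset.range d, (Polynomial.X - Polynomial.C (C (i : K) * z)) - Polynomial.C (z * b) := by
    simp [crv, map_prod, e0, e1, e2, hb]
  rw [key]
  set A : Polynomial (MvPolynomial (Fin 2) K) :=
    ∏ i ∈ Finset.range d, (Polynomial.X - Polynomial.C (C (i : K) * z)) with hA
  have hAm : A.Monic := Polynomial.monic_prod_of_monic _ _ fun i _ => Polynomial.monic_X_sub_C _
  have hAd : A.natDegree = d := by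
    rw [hA, Polynomial.natDegree_prod_of_monic _ _ fun i _ => Polynomial.monic_X_sub_C _]
    simp only [Polynomial.natDegree_X_sub_C]
    simp
  have hzp : Prime z := MvPolynomial.X_prime
  have hlt : (Polynomial.C (z * b)).degree < A.degree := by
    rw [Polynomial.degree_eq_natDegree hAm.ne_zero, hAd]
    exact lt_of_le_of_lt Polynomial.degree_C_le (by exact_mod_cast hd)
  have hm : (A - Polynomial.C (z * b)).Monic := hAm.sub_of_left hlt
  have hdeg : (A - Polynomial.C (z * b)).natDegree = d := by
    rw [Polynomial.natDegree_sub_C, hAd]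
  have hmap : (A - Polynomial.C (z * b)).map (Ideal.Quotient.mk (Ideal.span {z})) = Polynomial.X ^ d := by
    have hz0 : Ideal.Quotient.mk (Ideal.span {z}) z = 0 :=
      Ideal.Quotient.eq_zero_iff_mem.2 (Ideal.mem_span_singleton_self z)
    simp [hA, Polynomial.map_prod, hz0]
  have hP : (Ideal.span {z}).IsPrime := (Ideal.span_singleton_prime hzp.ne_zero).2 hzp
  refine Polynomial.irreducible_of_eisenstein_criterion hP ?_ ?_ ?_ ?_ hm.isPrimitive
  · rw [hm.leadingCoeff]
    exact fun h => hP.ne_top ((Ideal.eq_top_iff_one _).2 h)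
  · intro n hn
    rw [Polynomial.degree_eq_natDegree hm.ne_zero, hdeg] at hn
    have hn' : n < d := by exact_mod_cast hn
    rw [← Ideal.Quotient.eq_zero_iff_mem, ← Polynomial.coeff_map, hmap, Polynomial.coeff_X_pow,
      if_neg hn'.ne]
  · rw [Polynomial.degree_eq_natDegree hm.ne_zero, hdeg]
    exact_mod_cast hd
  · have hA0 : A.coeff 0 = 0 := by
      rw [Polynomial.coeff_zero_eq_eval_zero, hA, Polynomial.eval_prod]
      exact Finset.prod_eq_zero (Finset.mem_range.2 hd) (by simp)
    rw [Polynomial.coeff_sub, hA0, Polynomial.coeff_C_zero, zero_sub, neg_mem_iff,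
      Ideal.span_singleton_pow, Ideal.mem_span_singleton, pow_two]
    intro h
    have h1 : z ∣ b := (mul_dvd_mul_iff_left hzp.ne_zero).1 h
    obtain ⟨j, -, hj⟩ := (hzp.dvd_finsetProd_iff _).1 h1
    obtain ⟨c, hc⟩ := hj
    have := congrArg (MvPolynomial.eval ![(1 : K), 0]) hc
    simp [hz] at this

theorem Nproj_ge (f : MvPolynomial (Fin 3) ℤ) (B : ℕ) (T : Finset (ℕ × ℕ)) (hB : 1 ≤ B)
    (hT : ∀ p ∈ T, p.1 ≤ B ∧ p.2 ≤ B ∧ MvPolynomial.eval ![(p.1 : ℤ), (p.2 : ℤ), 1] f = 0) :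
    T.card ≤ Nproj f (B : ℝ) := by
  classical
  have hne (p : ℕ × ℕ) : (fun i => ((![(p.1 : ℤ), (p.2 : ℤ), 1] : Fin 3 → ℤ) i : ℚ)) ≠ 0 := by
    intro h
    have := congrFun h 2
    simp at this
  unfold Nproj
  rw [← Set.ncard_coe_finset]
  refine Set.ncard_le_ncard_of_injOn
    (fun p => Projectivization.mk ℚ (fun i => ((![(p.1 : ℤ), (p.2 : ℤ), 1] : Fin 3 → ℤ) i : ℚ)) (hne p))
    ?_ ?_ ?_
  · intro p hp
    obtain ⟨h1, h2, h3⟩ := hT p hp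
    refine ⟨_, hne p, ?_, h3, ?_, rfl⟩
    · rw [← Finset.normalize_gcd, normalize_eq_one]
      exact isUnit_of_dvd_one (Finset.gcd_dvd (f := ![(p.1 : ℤ), (p.2 : ℤ), 1]) (Finset.mem_univ 2))
    · intro i
      fin_cases i
      · simpa using h1
      · simpa using h2
      · simpa using hB
  · intro p _ q _ h
    obtain ⟨a, ha⟩ := (Projectivization.mk_eq_mk_iff' ℚ _ _ _ _).1 h
    have h2 := congrFun ha 2
    have h1 := congrFun ha 1
    have h0 := congrFun ha 0
    simp at h0 h1 h2
    subst h2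
    simp at h0 h1
    ext
    · exact h0.symm
    · exact h1.symm
  · let g : (Fin 3 → ℤ) → Projectivization ℚ (Fin 3 → ℚ) := fun v =>
      if hv : (fun i => (v i : ℚ)) ≠ 0 then Projectivization.mk ℚ _ hv
      else Projectivization.mk ℚ _ (hne (0, 0))
    refine ((Set.finite_Icc (fun _ : Fin 3 => -(B : ℤ)) (fun _ => (B : ℤ))).image g).subset ?_
    rintro P ⟨v, hv, -, -, hb, rfl⟩
    refine ⟨v, ?_, by simp only [g]; rw [dif_pos hv]⟩
    have hb' (i) : |v i| ≤ (B : ℤ) := by exact_mod_cast hb i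
    exact ⟨fun i => (abs_le.1 (hb' i)).1, fun i => (abs_le.1 (hb' i)).2⟩

theorem pow_bd (d : ℕ) (hd : 2 ≤ d) : (d : ℝ) ^ 2 ≤ (5 / 2 : ℝ) ^ d := by
  induction d, hd using Nat.le_induction with
  | base => norm_num
  | succ n hn ih =>
    have : (2 : ℝ) ≤ n := by exact_mod_cast hn
    rw [pow_succ (5 / 2 : ℝ)]
    push_cast
    nlinarith

theorem rpow_bd (d : ℕ) (hd : 2 ≤ d) : (d : ℝ) ^ (2 / (d : ℝ)) ≤ 5 / 2 := by
  have hd0 : (0 : ℝ) < d := by exact_mod_cast (by omega : 0 < d)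
  have h : ((d : ℝ) ^ (2 / (d : ℝ))) ^ d ≤ (5 / 2 : ℝ) ^ d := by
    rw [← Real.rpow_natCast, ← Real.rpow_mul hd0.le, div_mul_cancel₀ _ hd0.ne']
    exact_mod_cast pow_bd d hd
  exact le_of_pow_le_pow_left₀ (by omega) (by norm_num) h

/-- **Lower bound for plane curves.** For each integer `d ≥ 1` there are a homogeneous
polynomial `f ∈ ℤ[x_0,x_1,x_2]` of degree `d`, irreducible over the algebraic closure
of `ℚ`, and an integer `B ≥ 1`, such that `(1/5)·d²·B^(2/d) ≤ N(f,B)`. -/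
theorem lower_bound_projective_curves (d : ℕ) (hd : 1 ≤ d) :
    ∃ (f : MvPolynomial (Fin 3) ℤ) (B : ℕ),
      f.IsHomogeneous d ∧
      Irreducible (MvPolynomial.map (Int.castRingHom (AlgebraicClosure ℚ)) f) ∧
      1 ≤ B ∧
      (1 / 5 : ℝ) * (d : ℝ) ^ 2 * (B : ℝ) ^ (2 / (d : ℝ)) ≤ (Nproj f (B : ℝ) : ℝ) := by
  refine ⟨crv ℤ d, d, crv_hom ℤ d hd, ?_, hd, ?_⟩
  · rw [crv_map]
    exact crv_irred _ d hd
  · rcases hd.eq_or_lt with rfl | hd2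
    · have h := Nproj_ge (crv ℤ 1) 1 {(1, 1)} le_rfl (by simp [crv])
      have h' : (1 : ℝ) ≤ (Nproj (crv ℤ 1) ((1 : ℕ) : ℝ) : ℝ) := by exact_mod_cast h
      refine le_trans ?_ h'
      norm_num
    · have h := Nproj_ge (crv ℤ d) d (Finset.range d ×ˢ Finset.range (d - 1)) hd (by
        rintro ⟨i, j⟩ hp
        rw [Finset.mem_product, Finset.mem_range, Finset.mem_range] at hp
        obtain ⟨hi, hj⟩ := hp
        simp only at hi hj
        refine ⟨hi.le, by simp only; omega, ?_⟩
        simp only [crv, map_sub, map_mul, map_prod]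
        rw [Finset.prod_eq_zero (Finset.mem_range.2 hi) (by simp),
          Finset.prod_eq_zero (Finset.mem_range.2 hj) (by simp)]
        simp)
      have h' : ((d * (d - 1) : ℕ) : ℝ) ≤ (Nproj (crv ℤ d) (d : ℝ) : ℝ) := by
        exact_mod_cast (by simpa using h)
      refine le_trans ?_ h'
      rw [Nat.cast_mul, Nat.cast_sub hd, Nat.cast_one]
      have h2 : (2 : ℝ) ≤ d := by exact_mod_cast hd2
      have := mul_le_mul_of_nonneg_left (rpow_bd d hd2) (by positivity : (0 : ℝ) ≤ 1 / 5 * (d : ℝ) ^ 2)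
      nlinarith
end
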